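/- arXiv:2001.07425 — 2 statements merged into one kernel-verified Lean document; each statement's English description precedes it below -/
import Mathlib

section
/- Let $(X,\mu)$ and $(Y,\nu)$ be $\sigma$-finite measure spaces and let $D \subseteq X \times Y$ be a measurable set with $0 < (\mu \times \nu)(D) < \infty$. Then for every $\varepsilon > 0$ there exist a measurable set $D_X \subseteq X$ and a measurable set $D_Y \subseteq Y$ such that $(\mu \times \nu)((D_X \times D_Y) \setminus D) < \varepsilon \cdot (\mu \times \nu)(D_X \times D_Y) < \infty$. -/
open MeasureTheory
open scoped ENNReal

theorem rect_semiring {X Y : Type*} [MeasurableSpace X] [MeasurableSpace Y] :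
    IsSetSemiring (Set.image2 (fun (s : Set X) (t : Set Y) => s ×ˢ t)
      { s : Set X | MeasurableSet s } { t : Set Y | MeasurableSet t }) where
  empty_mem := ⟨∅, MeasurableSet.empty, ∅, MeasurableSet.empty, by simp⟩
  inter_mem := by
    rintro _ ⟨a, ha, b, hb, rfl⟩ _ ⟨c, hc, d, hd, rfl⟩
    exact ⟨a ∩ c, MeasurableSet.inter ha hc, b ∩ d, MeasurableSet.inter hb hd,
      Set.prod_inter_prod.symm⟩
  sdiff_eq_sUnion' := by
    classical
    rintro _ ⟨a, ha, b, hb, rfl⟩ _ ⟨c, hc, d, hd, rfl⟩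
    refine ⟨{(a \ c) ×ˢ b, (a ∩ c) ×ˢ (b \ d)}, ?_, ?_, ?_⟩
    · intro s hs
      simp only [Finset.coe_insert, Finset.coe_singleton, Set.mem_insert_iff,
        Set.mem_singleton_iff] at hs
      rcases hs with rfl | rfl
      · exact ⟨_, MeasurableSet.diff ha hc, _, hb, rfl⟩
      · exact ⟨_, MeasurableSet.inter ha hc, _, MeasurableSet.diff hb hd, rfl⟩
    · rw [Finset.coe_insert, Finset.coe_singleton]
      have key : Disjoint ((a \ c) ×ˢ b) ((a ∩ c) ×ˢ (b \ d)) := by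
        refine Set.disjoint_left.2 ?_
        rintro ⟨x, y⟩ h1 h2
        exact h1.1.2 h2.1.2
      exact Set.pairwise_pair.2 fun _ => ⟨key, key.symm⟩
    · ext ⟨x, y⟩
      simp only [Finset.coe_insert, Finset.coe_singleton, Set.sUnion_insert, Set.sUnion_singleton,
        Set.mem_sdiff, Set.mem_prod, Set.mem_union, Set.mem_inter_iff]
      tauto

/-- Almost-rectangle lemma: any measurable set of finite positive product measure
contains, up to relative measure `ε`, a measurable rectangle of finite positive measure. -/
theorem almost_rectangle
    {X Y : Type*} [MeasurableSpace X] [MeasurableSpace Y]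
    (μ : Measure X) (ν : Measure Y) [SigmaFinite μ] [SigmaFinite ν]
    (D : Set (X × Y)) (hD : MeasurableSet D)
    (hpos : 0 < (μ.prod ν) D) (hfin : (μ.prod ν) D < ⊤)
    (ε : ℝ≥0∞) (hε : 0 < ε) :
    ∃ (DX : Set X) (DY : Set Y), MeasurableSet DX ∧ MeasurableSet DY ∧
      (μ.prod ν) ((DX ×ˢ DY) \ D) < ε * (μ.prod ν) (DX ×ˢ DY) ∧
      (μ.prod ν) (DX ×ˢ DY) < ⊤ := by
  by_contra hcon
  set m := μ.prod ν with hm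
  set e : ℝ≥0∞ := min ε 1 with he
  have he0 : 0 < e := lt_min hε one_pos
  have he1 : e ≤ 1 := min_le_right _ _
  have H : ∀ (a : Set X) (b : Set Y), MeasurableSet a → MeasurableSet b → m (a ×ˢ b) < ⊤ →
      e * m (a ×ˢ b) ≤ m ((a ×ˢ b) \ D) := by
    intro a b ha hb hab
    by_contra hlt
    refine hcon ⟨a, b, ha, hb, (not_le.1 hlt).trans_le ?_, hab⟩
    gcongr
    exact min_le_left _ _
  obtain ⟨n, hn⟩ : ∃ n, 0 < m (D ∩ (spanningSets μ n ×ˢ spanningSets ν n)) := by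
    by_contra hall
    push Not at hall
    have h0 : m (⋃ n, D ∩ (spanningSets μ n ×ˢ spanningSets ν n)) = 0 :=
      measure_iUnion_null fun n => le_antisymm (hall n) bot_le
    rw [← Set.inter_iUnion] at h0
    have hU : (⋃ n, spanningSets μ n ×ˢ spanningSets ν n) = (Set.univ : Set (X × Y)) := by
      rw [Set.iUnion_prod_of_monotone (monotone_spanningSets μ) (monotone_spanningSets ν),
        iUnion_spanningSets, iUnion_spanningSets, Set.univ_prod_univ]
    rw [hU, Set.inter_univ] at h0
    exact hpos.ne' h0
  set A := spanningSets μ n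
  set B := spanningSets ν n
  have hA : MeasurableSet A := measurableSet_spanningSets μ n
  have hB : MeasurableSet B := measurableSet_spanningSets ν n
  have hS : m (A ×ˢ B) < ⊤ := by
    rw [hm, Measure.prod_prod]
    exact ENNReal.mul_lt_top (measure_spanningSets_lt_top μ n) (measure_spanningSets_lt_top ν n)
  set m' := m.restrict (A ×ˢ B) with hm'
  have : IsFiniteMeasure m' := ⟨by simpa [hm'] using hS⟩
  have hD' : 0 < m' D := by rwa [hm', Measure.restrict_apply hD]
  have hd : 0 < e * m' D / 2 := ENNReal.half_pos (mul_ne_zero he0.ne' hD'.ne')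
  obtain ⟨t, ht, hlt⟩ := exists_measure_symmDiff_lt_of_generateFrom_isSetSemiring
    (μ := m') (rect_semiring (X := X) (Y := Y))
    ⟨{Set.univ}, Set.countable_singleton _, by
      rintro _ rfl
      exact ⟨Set.univ, MeasurableSet.univ, Set.univ, MeasurableSet.univ, Set.univ_prod_univ⟩,
      by simp⟩ generateFrom_prod.symm hD hd
  obtain ⟨P, hP⟩ := rect_semiring.mem_supClosure_iff.1 ht
  have hrect : ∀ p ∈ P.parts, MeasurableSet p ∧ e * m' p ≤ m' (p \ D) := by
    intro p hp
    obtain ⟨a, ha, b, hb, rfl⟩ := hP hp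
    have hmp : MeasurableSet (a ×ˢ b) := MeasurableSet.prod ha hb
    refine ⟨hmp, ?_⟩
    simp only
    rw [hm', Measure.restrict_apply hmp, Measure.restrict_apply (hmp.diff hD),
      ← Set.inter_sdiff_right_comm, Set.prod_inter_prod]
    refine H _ _ (MeasurableSet.inter ha hA) (MeasurableSet.inter hb hB)
      (lt_of_le_of_lt (measure_mono ?_) hS)
    exact Set.prod_mono Set.inter_subset_right Set.inter_subset_right
  have hdisj := P.supIndep.pairwiseDisjoint
  have htU : t = ⋃ p ∈ P.parts, p := by
    conv_lhs => rw [← P.sup_parts]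
    simp
  have key : e * m' t ≤ m' (t \ D) := by
    have h1 : m' t = ∑ p ∈ P.parts, m' p := by
      conv_lhs => rw [htU]
      exact measure_biUnion_finset hdisj fun p hp => (hrect p hp).1
    have h2 : m' (t \ D) = ∑ p ∈ P.parts, m' (p \ D) := by
      have : t \ D = ⋃ p ∈ P.parts, p \ D := by
        conv_lhs => rw [htU]
        simp only [Set.iUnion_sdiff]
      rw [this]
      refine measure_biUnion_finset ?_ fun p hp => (hrect p hp).1.diff hD
      intro p hp q hq hpq
      exact (hdisj hp hq hpq).mono Set.sdiff_subset Set.sdiff_subset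
    rw [h1, h2, Finset.mul_sum]
    exact Finset.sum_le_sum fun p hp => (hrect p hp).2
  have h3 : m' (t \ D) ≤ m' (symmDiff t D) := measure_mono (by
    intro x hx; exact Or.inl hx)
  have h4 : m' D ≤ m' t + m' (symmDiff t D) := by
    refine (measure_mono ?_).trans (measure_union_le _ _)
    intro x hx
    by_cases hxt : x ∈ t
    · exact Or.inl hxt
    · exact Or.inr (Or.inr ⟨hx, hxt⟩)
  have : e * m' D < e * m' D := calc
    e * m' D ≤ e * (m' t + m' (symmDiff t D)) := by gcongr
    _ = e * m' t + e * m' (symmDiff t D) := mul_add _ _ _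
    _ ≤ m' (symmDiff t D) + 1 * m' (symmDiff t D) := by
      gcongr
      exact key.trans h3
    _ < e * m' D / 2 + e * m' D / 2 := by
      rw [one_mul]
      exact ENNReal.add_lt_add hlt hlt
    _ = e * m' D := ENNReal.add_halves _
  exact lt_irrefl _ this
end

section
/- Let $A$ be a $C^*$-algebra that is $*$-isomorphic to a $C^*$-subalgebra of $M_n(C(\Omega)) = M_n \otimes C(\Omega)$ for some $n \in \mathbb{N}$ and compact Hausdorff space $\Omega$ (i.e., $A$ is subhomogeneous and nuclear of this form). Then every compact linear map $\varphi : A \to A$ is completely compact. -/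
noncomputable section
set_option synthInstance.maxHeartbeats 1000000
set_option maxHeartbeats 1000000

attribute [local instance] Matrix.linftyOpNormedAddCommGroup Matrix.linftyOpNormedRing
  Matrix.linftyOpNormedAlgebra

/-- Complete compactness of `Φ` with respect to given families of matrix norms. -/
def CompletelyCompactWrt
    {V W : Type*} [AddCommGroup V] [Module ℂ V] [AddCommGroup W] [Module ℂ W]
    (NV : ∀ m : ℕ, Matrix (Fin m) (Fin m) V → ℝ)
    (NW : ∀ m : ℕ, Matrix (Fin m) (Fin m) W → ℝ)
    (Φ : V → W) : Prop :=
  ∀ ε > (0 : ℝ), ∃ F : Submodule ℂ W, FiniteDimensional ℂ F ∧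
    ∀ (m : ℕ) (x : Matrix (Fin m) (Fin m) V), NV m x ≤ 1 →
      ∃ y : Matrix (Fin m) (Fin m) W, (∀ i j, y i j ∈ F) ∧ NW m (x.map Φ - y) < ε

variable {Ω : Type*} [TopologicalSpace Ω] [CompactSpace Ω] [T2Space Ω] {n : ℕ}

/-- The canonical C*-matrix norms on a C*-subalgebra `A ⊆ M_n(C(Ω))`:
`M_m(A) ⊆ M_m(M_n(C(Ω))) ≅ C(Ω, M_{mn})` with supremum of pointwise operator norms. -/
def matNorm (S : StarSubalgebra ℂ (Matrix (Fin n) (Fin n) C(Ω, ℂ)))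
    (m : ℕ) (x : Matrix (Fin m) (Fin m) S) : ℝ :=
  ⨆ ω : Ω, ‖Matrix.toEuclideanCLM (𝕜 := ℂ) (n := Fin m × Fin n)
    (fun p q => ((x p.1 q.1 : Matrix (Fin n) (Fin n) C(Ω, ℂ)) p.2 q.2) ω)‖

set_option linter.unusedSectionVars false
set_option linter.style.haveILetI false
set_option linter.unusedVariables false
open scoped InnerProductSpace

namespace CCSub

section Rep

variable {A : Type*} [Ring A] [Algebra ℂ A] [StarRing A]

/-- Density theorem for irreducible finite-dimensional representations. -/
theorem surj_of_irr {V : Type*} [AddCommGroup V] [Module ℂ V] [FiniteDimensional ℂ V]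
    (ρ : A →ₐ[ℂ] Module.End ℂ V) (hnt : ∃ v : V, v ≠ 0)
    (irr : ∀ v : V, v ≠ 0 → ∀ w, ∃ a, ρ a v = w) (L : Module.End ℂ V) : ∃ a, ρ a = L := by
  letI : Module A V := Module.compHom V ρ.toRingHom
  have hsm : ∀ (a : A) (v : V), a • v = ρ a v := fun a v => rfl
  haveI : IsScalarTower ℂ A V := ⟨fun c a v => by simp [hsm]⟩
  haveI : Nontrivial V := by
    obtain ⟨v, hv⟩ := hnt
    exact ⟨⟨v, 0, hv⟩⟩
  haveI : IsSimpleModule A V := by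
    rw [isSimpleModule_iff_toSpanSingleton_surjective]
    refine ⟨inferInstance, fun v hv w => ?_⟩
    obtain ⟨a, ha⟩ := irr v hv w
    exact ⟨a, by simpa [hsm] using ha⟩
  have hS := (IsSimpleModule.algebraMap_end_bijective_of_isAlgClosed (A := A) (V := V) ℂ).2
  let f : Module.End (Module.End A V) V :=
    { toFun := L
      map_add' := L.map_add
      map_smul' := by
        intro g v
        obtain ⟨c, rfl⟩ := hS g
        simp }
  let b := Module.finBasis ℂ V
  classical
  obtain ⟨r, hr⟩ := jacobson_density f (Finset.univ.image b)
  refine ⟨r, b.ext fun i => ?_⟩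
  have := hr (b i) (by simp)
  exact this.symm

variable {E : Type*} [NormedAddCommGroup E] [InnerProductSpace ℂ E] [FiniteDimensional ℂ E]

/-- The orbit. -/
def orb (σ : A →ₐ[ℂ] (E →L[ℂ] E)) (ξ : E) : Submodule ℂ E where
  carrier := {η | ∃ a, σ a ξ = η}
  add_mem' := by
    rintro _ _ ⟨a, rfl⟩ ⟨b, rfl⟩
    exact ⟨a + b, by simp⟩
  zero_mem' := ⟨0, by simp⟩
  smul_mem' := by
    rintro c _ ⟨a, rfl⟩
    exact ⟨c • a, by simp⟩

/-- Irreducible vectors. -/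
def Irr (σ : A →ₐ[ℂ] (E →L[ℂ] E)) (ξ : E) : Prop :=
  ξ ≠ 0 ∧ ∀ a, σ a ξ ≠ 0 → ∃ b, σ b (σ a ξ) = ξ

theorem mem_orb_self (σ : A →ₐ[ℂ] (E →L[ℂ] E)) (ξ : E) : ξ ∈ orb σ ξ := ⟨1, by simp⟩

theorem orb_inv (σ : A →ₐ[ℂ] (E →L[ℂ] E)) (ξ : E) {η : E} (h : η ∈ orb σ ξ) (a : A) :
    σ a η ∈ orb σ ξ := by
  obtain ⟨b, rfl⟩ := h
  exact ⟨a * b, by simp⟩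

theorem orb_le (σ : A →ₐ[ℂ] (E →L[ℂ] E)) {V : Submodule ℂ E}
    (hV : ∀ a, ∀ η ∈ V, σ a η ∈ V) {ξ : E} (h : ξ ∈ V) : orb σ ξ ≤ V := by
  rintro _ ⟨a, rfl⟩
  exact hV a _ h

theorem Irr.trans {σ : A →ₐ[ℂ] (E →L[ℂ] E)} {ξ : E} (h : Irr σ ξ) {η ζ : E} (hη : η ∈ orb σ ξ)
    (h0 : η ≠ 0) (hζ : ζ ∈ orb σ ξ) : ∃ b, σ b η = ζ := by
  obtain ⟨a, rfl⟩ := hη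
  obtain ⟨c, rfl⟩ := hζ
  obtain ⟨b, hb⟩ := h.2 a h0
  exact ⟨c * b, by simp [hb]⟩

theorem Irr.irr {σ : A →ₐ[ℂ] (E →L[ℂ] E)} {ξ : E} (h : Irr σ ξ) {η : E} (hη : η ∈ orb σ ξ)
    (h0 : η ≠ 0) : Irr σ η :=
  ⟨h0, fun a ha => h.trans (orb_inv σ ξ hη a) ha hη⟩

theorem exists_irr (σ : A →ₐ[ℂ] (E →L[ℂ] E)) {V : Submodule ℂ E}
    (hV : ∀ a, ∀ η ∈ V, σ a η ∈ V) (h0 : V ≠ ⊥) : ∃ ξ ∈ V, Irr σ ξ := by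
  induction hd : Module.finrank ℂ V using Nat.strong_induction_on generalizing V with
  | _ d ih =>
  by_cases hex : ∃ η ∈ V, η ≠ 0 ∧ orb σ η ≠ V
  · obtain ⟨η, hη, h1, h2⟩ := hex
    have hle := orb_le σ hV hη
    have hlt : Module.finrank ℂ (orb σ η) < d := by
      rw [← hd]
      exact Submodule.finrank_lt_finrank_of_lt (lt_of_le_of_ne hle h2)
    obtain ⟨ξ, hξ, hi⟩ := ih _ hlt (V := orb σ η) (fun a ζ hζ => orb_inv σ η hζ a) (by
      intro hb
      apply h1
      have := mem_orb_self σ η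
      rw [hb] at this
      simpa using this) rfl
    exact ⟨ξ, hle hξ, hi⟩
  · push Not at hex
    obtain ⟨ξ, hξ, hξ0⟩ := Submodule.exists_mem_ne_zero_of_ne_bot h0
    refine ⟨ξ, hξ, hξ0, fun a ha => ?_⟩
    have := hex (σ a ξ) (hV a ξ hξ) ha
    rw [← this] at hξ
    exact hξ

theorem bound_of_irr (σ : A →ₐ[ℂ] (E →L[ℂ] E))
    (hstar : ∀ a ξ η, ⟪σ (star a) ξ, η⟫_ℂ = ⟪ξ, σ a η⟫_ℂ) (a : A) (M : ℝ) {V : Submodule ℂ E}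
    (hV : ∀ a, ∀ η ∈ V, σ a η ∈ V) (h : ∀ η ∈ V, Irr σ η → ‖σ a η‖ ≤ M * ‖η‖) :
    ∀ η ∈ V, ‖σ a η‖ ≤ M * ‖η‖ := by
  induction hd : Module.finrank ℂ V using Nat.strong_induction_on generalizing V with
  | _ d ih =>
  intro η hη
  by_cases h0 : V = ⊥
  · subst h0
    have : η = 0 := by simpa using hη
    simp [this]
  obtain ⟨ξ, hξ, hi⟩ := exists_irr σ hV h0
  set W := orb σ ξ with hW
  have hWV : W ≤ V := orb_le σ hV hξ
  let V' : Submodule ℂ E := V ⊓ Wᗮ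
  have hV' : ∀ a, ∀ η ∈ V', σ a η ∈ V' := by
    intro b ζ hζ
    refine ⟨hV b ζ hζ.1, ?_⟩
    rw [SetLike.mem_coe, Submodule.mem_orthogonal]
    intro u hu
    rw [← hstar]
    exact (Submodule.mem_orthogonal _ _).1 hζ.2 _ (orb_inv σ ξ hu _)
  have hlt : Module.finrank ℂ V' < d := by
    rw [← hd]
    refine Submodule.finrank_lt_finrank_of_lt (lt_of_le_of_ne inf_le_left ?_)
    intro he
    have h1 : ξ ∈ V' := by rw [he]; exact hξ
    have h2 := (Submodule.mem_orthogonal _ _).1 h1.2 ξ (mem_orb_self σ ξ)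
    exact hi.1 (inner_self_eq_zero.1 h2)
  have key := ih _ hlt hV' (fun ζ hζ hz => h ζ hζ.1 hz) rfl
  obtain ⟨u, hu, v, hv, huv⟩ : ∃ u ∈ W, ∃ v ∈ Wᗮ, η = u + v :=
    Submodule.exists_add_mem_mem_orthogonal (K := W) η
  have hvV : v ∈ V' := by
    refine ⟨?_, hv⟩
    have : v = η - u := by rw [huv]; abel
    rw [this]
    exact V.sub_mem hη (hWV hu)
  have h1 := key v hvV
  have h2 : ‖σ a u‖ ≤ M * ‖u‖ := by
    by_cases hu0 : u = 0
    · simp [hu0]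
    · exact h u (hWV hu) (hi.irr hu hu0)
  have o1 : ⟪u, v⟫_ℂ = 0 := (Submodule.mem_orthogonal _ _).1 hv u hu
  have o2 : ⟪σ a u, σ a v⟫_ℂ = 0 :=
    (Submodule.mem_orthogonal _ _).1 (hV' a v hvV).2 _ (orb_inv σ ξ hu a)
  have p1 := norm_add_sq_eq_norm_sq_add_norm_sq_of_inner_eq_zero u v o1
  have p2 := norm_add_sq_eq_norm_sq_add_norm_sq_of_inner_eq_zero _ _ o2
  by_cases hη0 : η = 0
  · simp [hη0]
  have hM : 0 ≤ M := by
    by_contra hneg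
    push Not at hneg
    have hu0 : ‖u‖ = 0 := by nlinarith [norm_nonneg u, norm_nonneg (σ a u)]
    have hv0 : ‖v‖ = 0 := by nlinarith [norm_nonneg v, norm_nonneg (σ a v)]
    apply hη0
    rw [huv, norm_eq_zero.1 hu0, norm_eq_zero.1 hv0, add_zero]
  rw [huv, map_add]
  apply le_of_sq_le_sq _ (by positivity)
  rw [mul_pow, pow_two ‖_ + _‖, p2, pow_two ‖u + v‖, p1]
  nlinarith [mul_self_le_mul_self (norm_nonneg _) h1, mul_self_le_mul_self (norm_nonneg _) h2]

end Rep

section Central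

variable {A : Type*} [Ring A] [Algebra ℂ A] [StarRing A]

/-- The product of all the `y j * star (y j)` with `j ≠ i`. -/
def bigProd {k : ℕ} (y : Fin k → A) (i : Fin k) : A :=
  (List.ofFn fun j => if j = i then 1 else y j * star (y j)).prod

/-- The central element. -/
def zel {k : ℕ} (y : Fin k → A) : A := ∑ i, star (y i) * bigProd y i * y i

variable {V : Type*} [NormedAddCommGroup V] [InnerProductSpace ℂ V] [FiniteDimensional ℂ V]

theorem ofFn_prod_apply {k : ℕ} (l : Fin k → Module.End ℂ V) (c : Fin k → ℂ) (u : V)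
    (h : ∀ i, l i u = c i • u) : (List.ofFn l).prod u = (∏ i, c i) • u := by
  induction k with
  | zero => simp
  | succ k ih =>
    rw [List.ofFn_succ, List.prod_cons, Module.End.mul_apply,
      ih (fun i => l i.succ) (fun i => c i.succ) (fun i => h i.succ), map_smul, h 0,
      Fin.prod_univ_succ, smul_smul, mul_comm]

theorem zel_scalar (τ : A →ₐ[ℂ] Module.End ℂ V)
    (hstar : ∀ a ξ η, ⟪τ (star a) ξ, η⟫_ℂ = ⟪ξ, τ a η⟫_ℂ) {k : ℕ} (y : Fin k → A)
    (b : OrthonormalBasis (Fin k) ℂ V) (i0 : Fin k) (s : Fin k → ℂ)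
    (hy : ∀ i j, τ (y i) (b j) = if i = j then s i • b i0 else 0) (v : V) :
    τ (zel y) v = ((∏ i, ‖s i‖ ^ 2 : ℝ) : ℂ) • v := by
  have hys : ∀ i, τ (star (y i)) (b i0) = (starRingEnd ℂ (s i)) • b i := by
    intro i
    apply b.repr.injective
    ext j
    rw [b.repr_apply_apply, b.repr_apply_apply, ← inner_conj_symm, hstar, hy, inner_smul_right]
    rw [orthonormal_iff_ite.1 b.orthonormal]
    by_cases hij : i = j
    · subst hij
      simp [inner_smul_right, orthonormal_iff_ite.1 b.orthonormal]
    · have : ¬ j = i := fun h => hij h.symm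
      simp [hij, this]
  have hP : ∀ i, τ (bigProd y i) (b i0)
      = (∏ j, if j = i then (1 : ℂ) else ((‖s j‖ ^ 2 : ℝ) : ℂ)) • b i0 := by
    intro i
    rw [bigProd, map_list_prod, List.map_ofFn]
    apply ofFn_prod_apply
    intro j
    by_cases hj : j = i
    · simp [hj]
    · simp only [Function.comp, hj, if_false, map_mul, Module.End.mul_apply, hys, map_smul, hy,
        if_true, smul_smul]
      congr 1
      rw [mul_comm, Complex.mul_conj, Complex.normSq_eq_norm_sq]
  have hb : ∀ j, τ (zel y) (b j) = ((∏ i, ‖s i‖ ^ 2 : ℝ) : ℂ) • b j := by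
    intro j
    rw [zel, map_sum, LinearMap.sum_apply, Finset.sum_eq_single j]
    · simp only [map_mul, Module.End.mul_apply, hy, if_true, map_smul, hP, hys, smul_smul]
      congr 1
      rw [← Finset.mul_prod_erase Finset.univ _ (Finset.mem_univ j), if_pos rfl, one_mul,
        Complex.ofReal_prod, ← Finset.mul_prod_erase Finset.univ _ (Finset.mem_univ j)]
      rw [Finset.prod_congr rfl (g := fun i => ((‖s i‖ ^ 2 : ℝ) : ℂ))
        (fun x hx => if_neg (Finset.ne_of_mem_erase hx))]
      rw [← Complex.normSq_eq_norm_sq (s j), ← Complex.mul_conj]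
      ring
    · intro i _ hij
      simp [Module.End.mul_apply, hy, hij]
    · simp
  have : τ (zel y) = ((∏ i, ‖s i‖ ^ 2 : ℝ) : ℂ) • (1 : Module.End ℂ V) := by
    apply b.toBasis.ext
    intro j
    rw [b.coe_toBasis, hb]
    simp
  rw [this]
  simp

theorem zel_central (τ : A →ₐ[ℂ] Module.End ℂ V)
    (hstar : ∀ a ξ η, ⟪τ (star a) ξ, η⟫_ℂ = ⟪ξ, τ a η⟫_ℂ) {k : ℕ} (i0 : Fin k)
    (w x : Fin k → A) (hw : ∀ i, star (w i) = w i)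
    (hww : ∀ i j, i ≠ j → ∀ v, τ (w i) (τ (w j) v) = 0) (hk : Module.finrank ℂ V ≤ k) :
    ∃ c : ℝ, (∀ v, τ (zel fun i => w i0 * x i * w i) v = (c : ℂ) • v) ∧
      (Module.finrank ℂ V < k → c = 0) := by
  by_cases hz : ∃ i, τ (w i) = 0
  · obtain ⟨i, hi⟩ := hz
    refine ⟨0, fun v => ?_, fun _ => rfl⟩
    rw [zel, map_sum, LinearMap.sum_apply, Finset.sum_eq_zero]
    · simp
    intro j _
    by_cases hj : j = i
    · subst hj
      simp [hi]
    · have : τ (bigProd (fun i => w i0 * x i * w i) j) = 0 := by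
        rw [bigProd, map_list_prod]
        apply List.prod_eq_zero
        rw [List.map_ofFn, List.mem_ofFn]
        refine ⟨i, ?_⟩
        have : ¬ i = j := fun h => hj h.symm
        simp [this, hi]
      simp only [map_mul, this, mul_zero, zero_mul, LinearMap.zero_apply]
  · push Not at hz
    have hex : ∀ i, ∃ v, τ (w i) v ≠ 0 := by
      intro i
      by_contra hcon
      push Not at hcon
      exact hz i (LinearMap.ext hcon)
    choose v hv using hex
    let u : Fin k → V := fun i => ((‖τ (w i) (v i)‖⁻¹ : ℝ) : ℂ) • τ (w i) (v i)
    have hu : Orthonormal ℂ u := by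
      constructor
      · intro i
        have : ‖τ (w i) (v i)‖ ≠ 0 := norm_ne_zero_iff.2 (hv i)
        simp only [u, norm_smul, Complex.norm_real, norm_inv, norm_norm]
        field_simp
      · intro i j hij
        simp only [u, inner_smul_left, inner_smul_right]
        rw [← hw i, hstar, hww i j hij]
        simp
    have hcard : Fintype.card (Fin k) = Module.finrank ℂ V := by
      apply le_antisymm
      · exact hu.linearIndependent.fintype_card_le_finrank
      · simpa using hk
    haveI : Nonempty (Fin k) := ⟨i0⟩
    let bb := basisOfOrthonormalOfCardEqFinrank hu hcard
    have hbb : ⇑bb = u := coe_basisOfOrthonormalOfCardEqFinrank hu hcard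
    let b : OrthonormalBasis (Fin k) ℂ V := bb.toOrthonormalBasis (by rw [hbb]; exact hu)
    have hb : ∀ i, b i = u i := by
      intro i
      simp [b, hbb]
    have hwu : ∀ i j, i ≠ j → τ (w i) (b j) = 0 := by
      intro i j hij
      rw [hb]
      simp only [u, map_smul, hww i j hij, smul_zero]
    have hw0 : ∀ i ξ, τ (w i) ξ = ⟪b i, τ (w i) ξ⟫_ℂ • b i := by
      intro i ξ
      conv_lhs => rw [← b.sum_repr' (τ (w i) ξ)]
      rw [Finset.sum_eq_single i]
      · intro j _ hij
        rw [← hw i, ← inner_conj_symm, hstar, ← inner_conj_symm, hwu i j hij.symm]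
        simp
      · simp
    refine ⟨∏ i, ‖⟪b i0, τ (w i0 * x i * w i) (b i)⟫_ℂ‖ ^ 2, fun ξ => ?_, fun h => ?_⟩
    · apply zel_scalar τ hstar _ b i0 (fun i => ⟪b i0, τ (w i0 * x i * w i) (b i)⟫_ℂ)
      intro i j
      by_cases hij : i = j
      · subst hij
        simp only [if_true, map_mul, Module.End.mul_apply]
        exact hw0 _ _
      · simp [hij, Module.End.mul_apply, hwu i j hij]
    · simp at hcard
      omega

end Central

section Restr

variable {A : Type*} [Ring A] [Algebra ℂ A] [StarRing A]
variable {E : Type*} [NormedAddCommGroup E] [InnerProductSpace ℂ E] [FiniteDimensional ℂ E]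

/-- restriction of a representation to an invariant subspace -/
def restr (σ : A →ₐ[ℂ] (E →L[ℂ] E)) (V : Submodule ℂ E) (hV : ∀ a, ∀ η ∈ V, σ a η ∈ V) :
    A →ₐ[ℂ] Module.End ℂ V where
  toFun a := (σ a).toLinearMap.restrict (hV a)
  map_one' := by ext; simp
  map_mul' a b := by ext; simp
  map_zero' := by ext; simp
  map_add' a b := by ext; simp
  commutes' c := by ext; simp [Algebra.algebraMap_eq_smul_one]

theorem restr_coe (σ : A →ₐ[ℂ] (E →L[ℂ] E)) (V : Submodule ℂ E) (hV : ∀ a, ∀ η ∈ V, σ a η ∈ V)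
    (a : A) (v : V) : ((restr σ V hV a v : V) : E) = σ a v := rfl

theorem restr_star (σ : A →ₐ[ℂ] (E →L[ℂ] E)) (V : Submodule ℂ E)
    (hV : ∀ a, ∀ η ∈ V, σ a η ∈ V) (hstar : ∀ a ξ η, ⟪σ (star a) ξ, η⟫_ℂ = ⟪ξ, σ a η⟫_ℂ)
    (a : A) (ξ η : V) : ⟪restr σ V hV (star a) ξ, η⟫_ℂ = ⟪ξ, restr σ V hV a η⟫_ℂ :=
  hstar a ξ η

theorem Irr.restr_irr {σ : A →ₐ[ℂ] (E →L[ℂ] E)} {ξ : E} (h : Irr σ ξ)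
    (v : orb σ ξ) (hv : v ≠ 0) (w : orb σ ξ) :
    ∃ a, restr σ (orb σ ξ) (fun a _ hη => orb_inv σ ξ hη a) a v = w := by
  obtain ⟨b, hb⟩ := h.trans v.2 (fun h => hv (Subtype.ext h)) w.2
  exact ⟨b, Subtype.ext hb⟩

/-- any linear map of the irreducible subspace is realized -/
theorem Irr.surj {σ : A →ₐ[ℂ] (E →L[ℂ] E)} {ξ : E} (h : Irr σ ξ) (L : Module.End ℂ (orb σ ξ)) :
    ∃ a, restr σ (orb σ ξ) (fun a _ hη => orb_inv σ ξ hη a) a = L :=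
  surj_of_irr _ ⟨⟨ξ, mem_orb_self σ ξ⟩, fun h0 => h.1 (congrArg Subtype.val h0)⟩ h.restr_irr L

end Restr

/-- A continuous field of finite dimensional representations. -/
structure Fld (A Ω E : Type*) [NormedRing A] [NormedAlgebra ℂ A] [StarRing A]
    [TopologicalSpace Ω] [NormedAddCommGroup E] [InnerProductSpace ℂ E] where
  rep : Ω → A →ₐ[ℂ] (E →L[ℂ] E)
  hstar : ∀ ω a ξ η, ⟪rep ω (star a) ξ, η⟫_ℂ = ⟪ξ, rep ω a η⟫_ℂ
  hcont : Continuous fun p : A × Ω × E => rep p.2.1 p.1 p.2.2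
  hcfc : ∀ h : A, star h = h → ∀ f : ℝ → ℝ, Continuous f → ∃ s : A, star s = s ∧
    ∀ ω ξ (l : ℝ), rep ω h ξ = (l : ℂ) • ξ → rep ω s ξ = (f l : ℂ) • ξ

section LemmaZ

variable {A Ω E : Type*} [NormedRing A] [NormedAlgebra ℂ A] [StarRing A]
    [TopologicalSpace Ω] [NormedAddCommGroup E] [InnerProductSpace ℂ E] [FiniteDimensional ℂ E]

/-- Functional calculus and orthogonality. -/
theorem Fld.orthog (P : Fld A Ω E) (h s t : A) (hh : star h = h) (f g : ℝ → ℝ)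
    (hs : ∀ ω ξ (l : ℝ), P.rep ω h ξ = (l : ℂ) • ξ → P.rep ω s ξ = (f l : ℂ) • ξ)
    (ht : ∀ ω ξ (l : ℝ), P.rep ω h ξ = (l : ℂ) • ξ → P.rep ω t ξ = (g l : ℂ) • ξ)
    (hfg : ∀ l, f l * g l = 0) (ω : Ω) (ξ : E) : P.rep ω s (P.rep ω t ξ) = 0 := by
  have hT : (P.rep ω h).toLinearMap.IsSymmetric := by
    intro x y
    have := P.hstar ω h x y
    rw [hh] at this
    exact this
  let b := hT.eigenvectorBasis rfl
  have hb : ∀ i, P.rep ω s (P.rep ω t (b i)) = 0 := by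
    intro i
    have := hT.apply_eigenvectorBasis rfl i
    have h1 : P.rep ω h (b i) = ((hT.eigenvalues rfl i : ℝ) : ℂ) • b i := this
    rw [ht ω _ _ h1, map_smul, hs ω _ _ h1, smul_smul, ← Complex.ofReal_mul, mul_comm, hfg]
    simp
  have : ((P.rep ω s).toLinearMap ∘ₗ (P.rep ω t).toLinearMap) = 0 := by
    apply b.toBasis.ext
    intro i
    simpa using hb i
  exact LinearMap.congr_fun this ξ

/-- The killers of `orb'` act transitively on `V0`. -/
theorem Fld.killer (P : Fld A Ω E) {ω0 ω' : Ω} {ξ0 ξ' : E} (h0 : Irr (P.rep ω0) ξ0) (a : A)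
    (ha : ∀ η ∈ orb (P.rep ω') ξ', P.rep ω' a η = 0) (ha0 : P.rep ω0 a ξ0 ≠ 0)
    {v w : E} (hv : v ∈ orb (P.rep ω0) ξ0) (hv0 : v ≠ 0) (hw : w ∈ orb (P.rep ω0) ξ0) :
    ∃ x, (∀ η ∈ orb (P.rep ω') ξ', P.rep ω' x η = 0) ∧ P.rep ω0 x v = w := by
  obtain ⟨b, hb⟩ := h0.trans hv hv0 (mem_orb_self _ _)
  obtain ⟨c, hc⟩ := h0.trans (orb_inv _ ξ0 (mem_orb_self _ _) a) ha0 hw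
  refine ⟨c * a * b, fun η hη => ?_, ?_⟩
  · simp [ha _ (orb_inv _ _ hη b)]
  · simp [hb, hc]

theorem Fld.lemmaZ (P : Fld A Ω E) {ω0 ω' : Ω} {ξ0 ξ' : E} (h0 : Irr (P.rep ω0) ξ0) (a : A)
    (ha : ∀ η ∈ orb (P.rep ω') ξ', P.rep ω' a η = 0) (ha0 : P.rep ω0 a ξ0 ≠ 0) :
    ∃ z : A, star z = z ∧
      (∀ ω ξ, Module.finrank ℂ (orb (P.rep ω) ξ) ≤ Module.finrank ℂ (orb (P.rep ω0) ξ0) →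
        ∃ c : ℝ, (∀ η ∈ orb (P.rep ω) ξ, P.rep ω z η = (c : ℂ) • η) ∧
        (Module.finrank ℂ (orb (P.rep ω) ξ) < Module.finrank ℂ (orb (P.rep ω0) ξ0) → c = 0)) ∧
      (∀ η ∈ orb (P.rep ω0) ξ0, P.rep ω0 z η = η) ∧
      (∀ η ∈ orb (P.rep ω') ξ', P.rep ω' z η = 0) := by
  set V := orb (P.rep ω0) ξ0 with hVdef
  set k := Module.finrank ℂ V with hk
  have hkpos : 0 < k := by
    haveI : Nontrivial V := ⟨⟨⟨ξ0, mem_orb_self _ _⟩, 0, fun h => h0.1 (congrArg Subtype.val h)⟩⟩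
    exact Module.finrank_pos
  let i0 : Fin k := ⟨0, hkpos⟩
  let v : OrthonormalBasis (Fin k) ℂ V := stdOrthonormalBasis ℂ V
  let L : Module.End ℂ V := v.toBasis.constr ℂ (fun i => ((i : ℕ) : ℂ) • v i)
  have hL : ∀ i, L (v i) = ((i : ℕ) : ℂ) • v i := by
    intro i
    have := v.toBasis.constr_basis ℂ (fun i => ((i : ℕ) : ℂ) • v i) i
    simp [L] at this ⊢
  obtain ⟨a1, ha1⟩ := h0.surj L
  have hav : ∀ i, P.rep ω0 a1 (v i) = ((i : ℕ) : ℂ) • (v i : E) := by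
    intro i
    have := congrArg Subtype.val ((LinearMap.congr_fun ha1 (v i)).trans (hL i))
    exact this
  have hsav : ∀ i, P.rep ω0 (star a1) (v i) = ((i : ℕ) : ℂ) • (v i : E) := by
    intro i
    have : (⟨P.rep ω0 (star a1) (v i), orb_inv _ _ (v i).2 _⟩ : V) = ((i : ℕ) : ℂ) • v i := by
      apply v.repr.injective
      ext j
      rw [v.repr_apply_apply, v.repr_apply_apply, ← inner_conj_symm, Submodule.coe_inner]
      rw [P.hstar, hav, ← Submodule.coe_smul, ← Submodule.coe_inner, inner_smul_right,
        inner_smul_right, orthonormal_iff_ite.1 v.orthonormal, orthonormal_iff_ite.1 v.orthonormal]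
      by_cases hij : i = j
      · simp [hij]
      · simp [hij, Ne.symm hij]
    exact congrArg Subtype.val this
  set h := a1 + star a1 with hh
  have hhs : star h = h := by simp [hh, add_comm]
  have hhv : ∀ i, P.rep ω0 h (v i) = ((2 * (i : ℕ) : ℝ) : ℂ) • (v i : E) := by
    intro i
    rw [hh, map_add, add_apply, hav, hsav, ← add_smul]
    congr 1
    push_cast
    ring
  let f : Fin k → ℝ → ℝ := fun i t => max 0 (1 - |t - 2 * (i : ℕ)|)
  have hfc : ∀ i, Continuous (f i) := fun i => by fun_prop
  choose w hw1 hw2 using fun i => P.hcfc h hhs (f i) (hfc i)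
  have hff : ∀ i j, i ≠ j → ∀ l, f i l * f j l = 0 := by
    intro i j hij l
    rw [mul_eq_zero]
    by_contra hcon
    push Not at hcon
    have h1 : |l - 2 * (i : ℕ)| < 1 := by
      by_contra hc
      exact hcon.1 (max_eq_left (by linarith))
    have h2 : |l - 2 * (j : ℕ)| < 1 := by
      by_contra hc
      exact hcon.2 (max_eq_left (by linarith))
    rw [abs_lt] at h1 h2
    have h3 : ((i : ℕ) : ℝ) < (j : ℕ) + 1 := by linarith
    have h4 : ((j : ℕ) : ℝ) < (i : ℕ) + 1 := by linarith
    norm_cast at h3 h4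
    exact hij (Fin.ext (by omega))
  have hww : ∀ i j, i ≠ j → ∀ ω ξ, P.rep ω (w i) (P.rep ω (w j) ξ) = 0 := fun i j hij =>
    P.orthog h (w i) (w j) hhs (f i) (f j) (hw2 i) (hw2 j) (hff i j hij)
  have hwv : ∀ i j, P.rep ω0 (w i) (v j) = if i = j then (v j : E) else 0 := by
    intro i j
    rw [hw2 i ω0 _ _ (hhv j)]
    by_cases hij : i = j
    · subst hij
      simp [f]
    · have h1 := hff i j hij (2 * (j : ℕ))
      have h2 : f j (2 * (j : ℕ)) = 1 := by simp [f]
      rw [h2, mul_one] at h1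
      simp [hij, h1]
  have hvne : ∀ i, (v i : E) ≠ 0 := fun i h => v.orthonormal.ne_zero i (Subtype.ext h)
  choose x hx1 hx2 using fun j => P.killer h0 a ha ha0 (v j).2 (hvne j) (v i0).2
  set y : Fin k → A := fun i => w i0 * x i * w i with hy
  have hyk : ∀ i, ∀ η ∈ orb (P.rep ω') ξ', P.rep ω' (y i) η = 0 := by
    intro i η hη
    simp [hy, hx1 i _ (orb_inv _ _ hη _)]
  refine ⟨star (zel y) * zel y, by simp, ?_, ?_, ?_⟩
  · intro ω ξ hle
    let τ := restr (P.rep ω) (orb (P.rep ω) ξ) (fun a _ hη => orb_inv _ ξ hη a)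
    have hτs := restr_star (P.rep ω) (orb (P.rep ω) ξ) (fun a _ hη => orb_inv _ ξ hη a)
      (P.hstar ω)
    obtain ⟨c, hc1, hc2⟩ := zel_central τ hτs i0 w x hw1
      (fun i j hij v => Subtype.ext (hww i j hij ω v)) hle
    have hc3 : ∀ η ∈ orb (P.rep ω) ξ, P.rep ω (zel y) η = (c : ℂ) • η := fun η hη =>
      congrArg Subtype.val (hc1 ⟨η, hη⟩)
    have hc4 : ∀ η ∈ orb (P.rep ω) ξ, P.rep ω (star (zel y)) η = (c : ℂ) • η := by
      intro η hη
      have : (⟨P.rep ω (star (zel y)) η, orb_inv _ _ hη _⟩ : orb (P.rep ω) ξ)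
          = (c : ℂ) • ⟨η, hη⟩ := by
        apply ext_inner_right ℂ
        intro u
        rw [Submodule.coe_inner, P.hstar, hc3 _ u.2, inner_smul_left, inner_smul_right,
          Complex.conj_ofReal, Submodule.coe_inner]
      exact congrArg Subtype.val this
    refine ⟨c * c, fun η hη => ?_, fun hlt => by rw [hc2 hlt, zero_mul]⟩
    rw [map_mul, mul_apply_eq_comp, hc3 η hη, map_smul, hc4 η hη, smul_smul]
    simp
  · let τ := restr (P.rep ω0) V (fun a _ hη => orb_inv _ ξ0 hη a)
    have hτs := restr_star (P.rep ω0) V (fun a _ hη => orb_inv _ ξ0 hη a) (P.hstar ω0)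
    have hc1 := zel_scalar τ hτs y v i0 (fun _ => 1) (by
      intro i j
      apply Subtype.ext
      change P.rep ω0 (y i) (v j) = _
      by_cases hij : i = j
      · subst hij
        simp [hy, hwv, hx2]
      · simp [hy, hwv, hij])
    have hc3 : ∀ η ∈ V, P.rep ω0 (zel y) η = η := fun η hη => by
      refine (congrArg Subtype.val (hc1 ⟨η, hη⟩)).trans ?_
      simp
    have hc4 : ∀ η ∈ V, P.rep ω0 (star (zel y)) η = η := by
      intro η hη
      have : (⟨P.rep ω0 (star (zel y)) η, orb_inv _ _ hη _⟩ : V) = ⟨η, hη⟩ := by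
        apply ext_inner_right ℂ
        intro u
        rw [Submodule.coe_inner, P.hstar, hc3 _ u.2, Submodule.coe_inner]
      exact congrArg Subtype.val this
    intro η hη
    rw [map_mul, mul_apply_eq_comp, hc3 η hη, hc4 η hη]
  · intro η hη
    have : P.rep ω' (zel y) η = 0 := by
      rw [zel, map_sum, sum_apply]
      apply Finset.sum_eq_zero
      intro i _
      simp [hyk i η hη]
    simp [this]

end LemmaZ

section Zorn

variable {A Ω E : Type*} [NormedRing A] [NormedAlgebra ℂ A] [StarRing A]
    [TopologicalSpace Ω] [NormedAddCommGroup E] [InnerProductSpace ℂ E] [FiniteDimensional ℂ E]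

/-- closed invariant sets -/
def Fld.CI (P : Fld A Ω E) (T : Set (Ω × E)) : Prop :=
  IsClosed T ∧ ∀ ω ξ, (ω, ξ) ∈ T → ∀ a, (ω, P.rep ω a ξ) ∈ T

/-- The finite rank approximation holds on `T`. -/
def Fld.Good (P : Fld A Ω E) (φ : A →ₗ[ℂ] A) (δ : ℝ) (T : Set (Ω × E)) : Prop :=
  ∃ R : A →ₗ[ℂ] A, IsCompactOperator R ∧ (∃ F : Submodule ℂ A, FiniteDimensional ℂ F ∧
    ∀ x, R x ∈ F) ∧ ∃ δ' < δ, ∀ x, ‖x‖ ≤ 1 → ∀ ω ξ, (ω, ξ) ∈ T →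
      ‖P.rep ω (φ x - R x) ξ‖ ≤ δ' * ‖ξ‖

theorem Fld.CI.orb {P : Fld A Ω E} {T : Set (Ω × E)} (hT : P.CI T) {ω : Ω} {ξ η : E}
    (h : (ω, ξ) ∈ T) (hη : η ∈ orb (P.rep ω) ξ) : (ω, η) ∈ T := by
  obtain ⟨a, rfl⟩ := hη
  exact hT.2 _ _ h a

theorem Fld.cont_act (P : Fld A Ω E) (a : A) : Continuous fun p : Ω × E => P.rep p.1 a p.2 :=
  P.hcont.comp (by fun_prop : Continuous fun p : Ω × E => (a, p.1, p.2))

theorem Fld.chain [CompactSpace Ω] (P : Fld A Ω E) (φ : A →ₗ[ℂ] A) (hφ : IsCompactOperator φ)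
    (δ : ℝ) (c : Set (Set (Ω × E))) (hc : ∀ T ∈ c, P.CI T) (hch : IsChain (· ⊆ ·) c)
    (hne : c.Nonempty) (hg : P.Good φ δ (⋂₀ c)) : ∃ T ∈ c, P.Good φ δ T := by
  obtain ⟨R, hRc, hRF, δ', hδ', hR⟩ := hg
  by_contra hcon
  push Not at hcon
  set d := (δ' + δ) / 2 with hd
  have hd1 : δ' < d := by rw [hd]; linarith
  have hd2 : d < δ := by rw [hd]; linarith
  have hcomp : IsCompactOperator (φ - R) := hφ.sub hRc
  set K := closure ((φ - R) '' Metric.closedBall 0 1) with hK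
  have hKc : IsCompact K :=
    IsCompactOperator.isCompact_closure_image_closedBall (f := φ - R) hcomp 1
  let B : c → Set (A × Ω × E) := fun T =>
    {p | p.1 ∈ K ∧ ‖p.2.2‖ = 1 ∧ p.2 ∈ T.1 ∧ d ≤ ‖P.rep p.2.1 p.1 p.2.2‖}
  have hBcl : ∀ T, IsClosed (B T) := by
    intro T
    refine IsClosed.inter (isClosed_closure.preimage continuous_fst) (IsClosed.inter ?_
      (IsClosed.inter ((hc T.1 T.2).1.preimage continuous_snd) ?_))
    · exact isClosed_eq (by fun_prop) continuous_const
    · exact isClosed_le continuous_const P.hcont.norm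
  have hBc : ∀ T, IsCompact (B T) := by
    intro T
    refine IsCompact.of_isClosed_subset (hKc.prod (isCompact_univ.prod (isCompact_sphere (0 : E) 1)))
      (hBcl T) ?_
    rintro ⟨a, ω, ξ⟩ ⟨h1, h2, h3, h4⟩
    exact ⟨h1, Set.mem_univ _, by simpa using h2⟩
  have hBn : ∀ T, (B T).Nonempty := by
    intro T
    have h1 := hcon T.1 T.2
    by_contra hemp
    apply h1
    refine ⟨R, hRc, hRF, d, hd2, fun x hx ω ξ hξ => ?_⟩
    by_contra hlt
    push Not at hlt
    apply hemp
    have hξ0 : ξ ≠ 0 := by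
      rintro rfl
      simp at hlt
    have hn : 0 < ‖ξ‖ := norm_pos_iff.2 hξ0
    refine ⟨(φ x - R x, ω, ((‖ξ‖⁻¹ : ℝ) : ℂ) • ξ), ?_, ?_, ?_, ?_⟩
    · exact subset_closure ⟨x, by simpa using hx, rfl⟩
    · simp only [norm_smul, Complex.norm_real, norm_inv, norm_norm]
      field_simp
    · have := (hc T.1 T.2).2 ω ξ hξ (algebraMap ℂ A ((‖ξ‖⁻¹ : ℝ) : ℂ))
      rw [AlgHom.commutes] at this
      simpa [Algebra.algebraMap_eq_smul_one] using this
    · simp only [map_smul, norm_smul, Complex.norm_real, norm_inv, norm_norm]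
      rw [inv_mul_eq_div, le_div_iff₀ hn]
      exact hlt.le
  haveI : Nonempty c := hne.to_subtype
  obtain ⟨⟨a, ω, ξ⟩, hp⟩ := IsCompact.nonempty_iInter_of_directed_nonempty_isCompact_isClosed B
    (by
      intro T1 T2
      rcases hch.total T1.2 T2.2 with h | h
      · exact ⟨T1, subset_rfl, fun p hp => ⟨hp.1, hp.2.1, h hp.2.2.1, hp.2.2.2⟩⟩
      · exact ⟨T2, fun p hp => ⟨hp.1, hp.2.1, h hp.2.2.1, hp.2.2.2⟩, subset_rfl⟩) hBn hBc hBcl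
  rw [Set.mem_iInter] at hp
  have hmem : (ω, ξ) ∈ ⋂₀ c := fun T hT => (hp ⟨T, hT⟩).2.2.1
  have hp0 := hp (Classical.arbitrary c)
  have hle : ‖P.rep ω a ξ‖ ≤ δ' * ‖ξ‖ := by
    have hcl : IsClosed {a : A | ‖P.rep ω a ξ‖ ≤ δ' * ‖ξ‖} := by
      refine isClosed_le (Continuous.norm ?_) continuous_const
      exact P.hcont.comp (by fun_prop : Continuous fun a : A => (a, ω, ξ))
    refine closure_minimal ?_ hcl hp0.1
    rintro _ ⟨x, hx, rfl⟩
    exact hR x (by simpa using hx) ω ξ hmem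
  have h1 := hp0.2.1
  have h2 := hp0.2.2.2
  simp only at h1 h2
  rw [h1] at hle
  linarith

theorem Fld.glue (P : Fld A Ω E) (φ : A →ₗ[ℂ] A) (δ : ℝ) {T : Set (Ω × E)} (hT : P.CI T)
    (hng : ¬ P.Good φ δ T) (hmin : ∀ T', P.CI T' → T' ⊆ T → T' ≠ T → P.Good φ δ T')
    (z : A) (hzs : star z = z)
    (hz : ∀ ω ξ, (ω, ξ) ∈ T → Irr (P.rep ω) ξ → ∃ c : ℝ, ∀ η ∈ orb (P.rep ω) ξ,
      P.rep ω z η = (c : ℂ) • η)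
    {ω0 ω1 : Ω} {ξ0 ξ1 : E} (h0 : (ω0, ξ0) ∈ T) (h1 : (ω1, ξ1) ∈ T) (hξ0 : ξ0 ≠ 0) (hξ1 : ξ1 ≠ 0)
    {l0 l1 : ℝ} (hl0 : P.rep ω0 z ξ0 = (l0 : ℂ) • ξ0) (hl1 : P.rep ω1 z ξ1 = (l1 : ℂ) • ξ1)
    (hl : l0 < l1) : False := by
  obtain ⟨β, hβ1, hβ2⟩ := exists_between hl
  obtain ⟨α, hα1, hα2⟩ := exists_between hβ2
  let q : A → Ω × E → ℝ := fun b p => (⟪P.rep p.1 z (P.rep p.1 b p.2), P.rep p.1 b p.2⟫_ℂ).re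
  let N : A → Ω × E → ℝ := fun b p => ‖P.rep p.1 b p.2‖ ^ 2
  have hqc : ∀ b, Continuous (q b) := by
    intro b
    have h1 : Continuous fun p : Ω × E => P.rep p.1 z (P.rep p.1 b p.2) := by
      have := P.cont_act (z * b)
      simpa using this
    exact Complex.continuous_re.comp (h1.inner (P.cont_act b))
  have hNc : ∀ b, Continuous (N b) := fun b => (P.cont_act b).norm.pow 2
  have hqs : ∀ ω ξ (l : ℝ) b, P.rep ω z (P.rep ω b ξ) = (l : ℂ) • P.rep ω b ξ →
      q b (ω, ξ) = l * N b (ω, ξ) := by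
    intro ω ξ l b h
    simp only [q, N, h]
    rw [inner_smul_left, inner_self_eq_norm_sq_to_K, Complex.conj_ofReal]
    rw [Complex.re_ofReal_mul]
    congr 1
    norm_cast
  let T1 : Set (Ω × E) := {p | p ∈ T ∧ ∀ b, q b p ≤ α * N b p}
  let T2 : Set (Ω × E) := {p | p ∈ T ∧ ∀ b, β * N b p ≤ q b p}
  have hT1 : P.CI T1 := by
    constructor
    · have hTi : IsClosed T := hT.1
      have : IsClosed (⋂ b, {p : Ω × E | q b p ≤ α * N b p}) :=
        isClosed_iInter fun b => isClosed_le (hqc b) (continuous_const.mul (hNc b))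
      convert hTi.inter this using 1
      ext p
      simp [T1]
    · rintro ω ξ ⟨h1, h2⟩ a
      refine ⟨hT.2 _ _ h1 a, fun b => ?_⟩
      have := h2 (b * a)
      simpa [q, N] using this
  have hT2 : P.CI T2 := by
    constructor
    · have hTi : IsClosed T := hT.1
      have : IsClosed (⋂ b, {p : Ω × E | β * N b p ≤ q b p}) :=
        isClosed_iInter fun b => isClosed_le (continuous_const.mul (hNc b)) (hqc b)
      convert hTi.inter this using 1
      ext p
      simp [T2]
    · rintro ω ξ ⟨h1, h2⟩ a
      refine ⟨hT.2 _ _ h1 a, fun b => ?_⟩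
      have := h2 (b * a)
      simpa [q, N] using this
  have hg1 : P.Good φ δ T1 := by
    refine hmin T1 hT1 (fun p hp => hp.1) fun heq => ?_
    have hm : (ω1, ξ1) ∈ T1 := heq ▸ h1
    have h3 := hm.2 1
    rw [hqs ω1 ξ1 l1 1 (by simpa using hl1)] at h3
    have : 0 < N 1 (ω1, ξ1) := by
      simp only [N, map_one, one_apply_eq_self]
      have := norm_pos_iff.2 hξ1
      positivity
    nlinarith
  have hg2 : P.Good φ δ T2 := by
    refine hmin T2 hT2 (fun p hp => hp.1) fun heq => ?_
    have hm : (ω0, ξ0) ∈ T2 := heq ▸ h0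
    have h3 := hm.2 1
    rw [hqs ω0 ξ0 l0 1 (by simpa using hl0)] at h3
    have : 0 < N 1 (ω0, ξ0) := by
      simp only [N, map_one, one_apply_eq_self]
      have := norm_pos_iff.2 hξ0
      positivity
    nlinarith
  obtain ⟨R1, hR1c, ⟨F1, hF1, hRF1⟩, δ1, hδ1, hR1⟩ := hg1
  obtain ⟨R2, hR2c, ⟨F2, hF2, hRF2⟩, δ2, hδ2, hR2⟩ := hg2
  let f : ℝ → ℝ := fun c => max 0 (min 1 ((α - c) / (α - β)))
  have hab : 0 < α - β := by linarith
  obtain ⟨e, hes, he⟩ := P.hcfc z hzs f (by fun_prop)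
  apply hng
  refine ⟨LinearMap.mulLeft ℂ e ∘ₗ R1 + LinearMap.mulLeft ℂ (1 - e) ∘ₗ R2, ?_,
    ⟨F1.map (LinearMap.mulLeft ℂ e) ⊔ F2.map (LinearMap.mulLeft ℂ (1 - e)), inferInstance, ?_⟩,
    max δ1 δ2, max_lt hδ1 hδ2, ?_⟩
  · have c1 : IsCompactOperator (⇑(ContinuousLinearMap.mul ℂ A e) ∘ R1) := hR1c.clm_comp _
    have c2 : IsCompactOperator (⇑(ContinuousLinearMap.mul ℂ A (1 - e)) ∘ R2) := hR2c.clm_comp _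
    exact c1.add c2
  · intro x
    exact Submodule.add_mem_sup (Submodule.mem_map_of_mem (hRF1 x))
      (Submodule.mem_map_of_mem (hRF2 x))
  · intro x hx ω ξ hξ
    refine bound_of_irr (P.rep ω) (P.hstar ω) _ _ (V := orb (P.rep ω) ξ)
      (fun a η hη => orb_inv _ ξ hη a) ?_ ξ (mem_orb_self _ _)
    intro η hη hirr
    have hηT : (ω, η) ∈ T := hT.orb hξ hη
    obtain ⟨c, hc⟩ := hz ω η hηT hirr
    have hq : ∀ b, q b (ω, η) = c * N b (ω, η) := fun b => hqs ω η c b (hc _ ⟨b, rfl⟩)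
    have hN : ∀ b, 0 ≤ N b (ω, η) := fun b => by positivity
    have hb1 : c ≤ α → ‖P.rep ω (φ x - R1 x) η‖ ≤ δ1 * ‖η‖ := by
      intro hca
      refine hR1 x hx ω η ⟨hηT, fun b => ?_⟩
      rw [hq]
      exact mul_le_mul_of_nonneg_right hca (hN b)
    have hb2 : β ≤ c → ‖P.rep ω (φ x - R2 x) η‖ ≤ δ2 * ‖η‖ := by
      intro hca
      refine hR2 x hx ω η ⟨hηT, fun b => ?_⟩
      rw [hq]
      exact mul_le_mul_of_nonneg_right hca (hN b)
    have hx' : φ x - (LinearMap.mulLeft ℂ e ∘ₗ R1 + LinearMap.mulLeft ℂ (1 - e) ∘ₗ R2) x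
        = e * (φ x - R1 x) + (φ x - R2 x) - e * (φ x - R2 x) := by
      simp only [LinearMap.add_apply, LinearMap.comp_apply, LinearMap.mulLeft_apply]
      noncomm_ring
    have hact : ∀ y, P.rep ω e (P.rep ω y η) = (f c : ℂ) • P.rep ω y η := fun y =>
      he ω _ c (hc _ ⟨y, rfl⟩)
    have hv : P.rep ω (φ x - (LinearMap.mulLeft ℂ e ∘ₗ R1 + LinearMap.mulLeft ℂ (1 - e) ∘ₗ R2) x) η
        = (f c : ℂ) • P.rep ω (φ x - R1 x) η + ((1 - f c : ℝ) : ℂ) • P.rep ω (φ x - R2 x) η := by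
      rw [hx', map_sub, map_add, map_mul, map_mul, sub_apply, add_apply, mul_apply_eq_comp,
        mul_apply_eq_comp, hact, hact]
      push_cast
      rw [sub_smul, one_smul]
      abel
    have hf0 : 0 ≤ f c := le_max_left _ _
    have hf1 : f c ≤ 1 := max_le zero_le_one (min_le_left _ _)
    have hm1 : f c * ‖P.rep ω (φ x - R1 x) η‖ ≤ f c * (max δ1 δ2 * ‖η‖) := by
      by_cases hca : c ≤ α
      · refine mul_le_mul_of_nonneg_left ((hb1 hca).trans ?_) hf0
        exact mul_le_mul_of_nonneg_right (le_max_left _ _) (norm_nonneg _)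
      · have : f c = 0 := by
          apply max_eq_left
          refine (min_le_right _ _).trans ?_
          exact div_nonpos_of_nonpos_of_nonneg (by linarith) hab.le
        simp [this]
    have hm2 : (1 - f c) * ‖P.rep ω (φ x - R2 x) η‖ ≤ (1 - f c) * (max δ1 δ2 * ‖η‖) := by
      by_cases hca : β ≤ c
      · refine mul_le_mul_of_nonneg_left ((hb2 hca).trans ?_) (by linarith)
        exact mul_le_mul_of_nonneg_right (le_max_right _ _) (norm_nonneg _)
      · have : f c = 1 := by
          have h1 : 1 ≤ (α - c) / (α - β) := by
            rw [le_div_iff₀ hab]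
            linarith
          simp [f, min_eq_left h1]
        simp [this]
    rw [hv]
    refine (norm_add_le _ _).trans ?_
    rw [norm_smul, norm_smul, Complex.norm_real, Complex.norm_real, Real.norm_of_nonneg hf0,
      Real.norm_of_nonneg (by linarith)]
    linarith

theorem Fld.good_of_kill (P : Fld A Ω E) (φ : A →ₗ[ℂ] A) (hφ : IsCompactOperator φ) {δ : ℝ}
    (hδ : 0 < δ) {T : Set (Ω × E)} (hT : P.CI T) (ω0 : Ω) (V : Submodule ℂ E)
    (hk : ∀ a : A, (∀ η ∈ V, P.rep ω0 a η = 0) → ∀ ω ξ, (ω, ξ) ∈ T → Irr (P.rep ω) ξ →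
      P.rep ω a ξ = 0) : P.Good φ δ T := by
  let b := Module.finBasis ℂ V
  let g0 : A →ₗ[ℂ] (Fin (Module.finrank ℂ V) → E) :=
    { toFun := fun a i => P.rep ω0 a (b i)
      map_add' := fun x y => by ext i; simp
      map_smul' := fun x y => by ext i; simp }
  let g : A →L[ℂ] (Fin (Module.finrank ℂ V) → E) := ⟨g0, by
    refine continuous_pi fun i => ?_
    exact P.hcont.comp (by fun_prop : Continuous fun a : A => (a, ω0, (b i : E)))⟩
  let g' : A →L[ℂ] (LinearMap.range g0) := g.codRestrict _ (fun a => ⟨a, rfl⟩)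
  obtain ⟨s, hs⟩ := g'.toLinearMap.exists_rightInverse_of_surjective (by
    rw [LinearMap.range_eq_top]
    rintro ⟨_, a, rfl⟩
    exact ⟨a, rfl⟩)
  let sc : (LinearMap.range g0) →L[ℂ] A := LinearMap.toContinuousLinearMap s
  refine ⟨s ∘ₗ g'.toLinearMap ∘ₗ φ, ?_, ⟨LinearMap.range s, inferInstance, fun x => ⟨_, rfl⟩⟩,
    0, hδ, ?_⟩
  · exact hφ.clm_comp (sc ∘L g')
  · intro x hx ω ξ hξ
    set a := φ x - (s ∘ₗ g'.toLinearMap ∘ₗ φ) x with ha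
    have hga : g' a = 0 := by
      have h1 : g' (s (g' (φ x))) = g' (φ x) := LinearMap.congr_fun hs (g' (φ x))
      rw [ha, map_sub]
      exact sub_eq_zero.2 h1.symm
    have hka : ∀ η ∈ V, P.rep ω0 a η = 0 := by
      have h2 : (P.rep ω0 a).toLinearMap ∘ₗ V.subtype = 0 := by
        apply b.ext
        intro i
        have h3 : g0 a = 0 := congrArg Subtype.val hga
        exact congrFun h3 i
      intro η hη
      exact LinearMap.congr_fun h2 ⟨η, hη⟩
    refine bound_of_irr (P.rep ω) (P.hstar ω) _ _ (V := orb (P.rep ω) ξ)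
      (fun a η hη => orb_inv _ ξ hη a) ?_ ξ (mem_orb_self _ _)
    intro η hη hirr
    rw [hk a hka ω η (hT.orb hξ hη) hirr]
    simp

theorem Fld.main [CompactSpace Ω] (P : Fld A Ω E) (φ : A →ₗ[ℂ] A) (hφ : IsCompactOperator φ)
    {δ : ℝ} (hδ : 0 < δ) : P.Good φ δ Set.univ := by
  by_contra hng
  obtain ⟨T, -, hTm⟩ := zorn_superset_nonempty {T | P.CI T ∧ ¬ P.Good φ δ T} (by
    intro c hc hch hne
    refine ⟨⋂₀ c, ⟨⟨isClosed_sInter fun T hT => (hc hT).1.1, fun ω ξ h a T hT =>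
      (hc hT).1.2 ω ξ (h T hT) a⟩, fun hg => ?_⟩, fun s hs => Set.sInter_subset_of_mem hs⟩
    obtain ⟨T, hT, hgT⟩ := P.chain φ hφ δ c (fun T hT => (hc hT).1) hch hne hg
    exact (hc hT).2 hgT) Set.univ ⟨⟨isClosed_univ, fun _ _ _ _ => trivial⟩, hng⟩
  obtain ⟨hT, hTg⟩ := hTm.prop
  have hmin : ∀ T', P.CI T' → T' ⊆ T → T' ≠ T → P.Good φ δ T' := by
    intro T' h1 h2 h3
    by_contra h4
    exact h3 (Set.Subset.antisymm h2 (hTm.le_of_le ⟨h1, h4⟩ h2))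
  by_cases hex : ∃ ω ξ, (ω, ξ) ∈ T ∧ Irr (P.rep ω) ξ
  · let D : Set ℕ := {d | ∃ ω ξ, (ω, ξ) ∈ T ∧ Irr (P.rep ω) ξ ∧
      Module.finrank ℂ (orb (P.rep ω) ξ) = d}
    have hDn : D.Nonempty := by
      obtain ⟨ω, ξ, h1, h2⟩ := hex
      exact ⟨_, ω, ξ, h1, h2, rfl⟩
    have hDb : BddAbove D := by
      refine ⟨Module.finrank ℂ E, ?_⟩
      rintro _ ⟨ω, ξ, h1, h2, rfl⟩
      exact Submodule.finrank_le _
    obtain ⟨ω0, ξ0, h0T, h0, hk⟩ := Nat.sSup_mem hDn hDb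
    have hmax : ∀ ω ξ, (ω, ξ) ∈ T → Irr (P.rep ω) ξ →
        Module.finrank ℂ (orb (P.rep ω) ξ) ≤ Module.finrank ℂ (orb (P.rep ω0) ξ0) := by
      intro ω ξ h1 h2
      rw [hk]
      exact le_csSup hDb ⟨ω, ξ, h1, h2, rfl⟩
    apply hTg
    refine P.good_of_kill φ hφ hδ hT ω0 (orb (P.rep ω0) ξ0) ?_
    intro a ha ω1 ξ1 h1T h1
    by_contra ha1
    rcases (hmax ω1 ξ1 h1T h1).lt_or_eq with hlt | heq
    · obtain ⟨z, hzs, hz1, hz2, hz3⟩ := P.lemmaZ (ω' := ω0) (ξ' := 0) h0 1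
        (by rintro _ ⟨a, rfl⟩; simp) (by simpa using h0.1)
      obtain ⟨c, hc1, hc2⟩ := hz1 ω1 ξ1 hlt.le
      rw [hc2 hlt] at hc1
      exact P.glue φ δ hT hTg hmin z hzs (fun ω ξ h h' => (hz1 ω ξ (hmax ω ξ h h')).imp
        fun c hc => hc.1) h1T h0T h1.1 h0.1 (hc1 _ (mem_orb_self _ _))
        (l1 := 1) (by simpa using hz2 _ (mem_orb_self _ _)) zero_lt_one
    · obtain ⟨z, hzs, hz1, hz2, hz3⟩ := P.lemmaZ h1 a ha ha1
      rw [heq] at hz1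
      exact P.glue φ δ hT hTg hmin z hzs (fun ω ξ h h' => (hz1 ω ξ (hmax ω ξ h h')).imp
        fun c hc => hc.1) h0T h1T h0.1 h1.1 (l0 := 0) (by simpa using hz3 _ (mem_orb_self _ _))
        (l1 := 1) (by simpa using hz2 _ (mem_orb_self _ _)) zero_lt_one
  · apply hTg
    refine ⟨0, isCompactOperator_zero, ⟨⊥, inferInstance, fun x => by simp⟩, 0, hδ, ?_⟩
    intro x hx ω ξ hξ
    refine bound_of_irr (P.rep ω) (P.hstar ω) _ _ (V := orb (P.rep ω) ξ)
      (fun a η hη => orb_inv _ ξ hη a) ?_ ξ (mem_orb_self _ _)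
    intro η hη hirr
    exact absurd ⟨ω, η, hT.orb hξ hη, hirr⟩ hex

end Zorn

section Concrete

/-- the evaluation representation -/
def evRep (S : StarSubalgebra ℂ (Matrix (Fin n) (Fin n) C(Ω, ℂ))) (ω : Ω) :
    S →ₐ[ℂ] (EuclideanSpace ℂ (Fin n) →L[ℂ] EuclideanSpace ℂ (Fin n)) :=
  ((Matrix.toEuclideanCLM (𝕜 := ℂ) (n := Fin n)).toAlgEquiv.toAlgHom.comp
    (ContinuousMap.evalAlgHom ℂ ℂ ω).mapMatrix).comp S.toSubalgebra.val

theorem evRep_apply (S : StarSubalgebra ℂ (Matrix (Fin n) (Fin n) C(Ω, ℂ))) (ω : Ω) (a : S) :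
    evRep S ω a = Matrix.toEuclideanCLM (𝕜 := ℂ) (n := Fin n)
      (fun i j => (a : Matrix (Fin n) (Fin n) C(Ω, ℂ)) i j ω) := rfl

theorem evRep_coord (S : StarSubalgebra ℂ (Matrix (Fin n) (Fin n) C(Ω, ℂ))) (ω : Ω) (a : S)
    (ξ : EuclideanSpace ℂ (Fin n)) (i : Fin n) :
    evRep S ω a ξ i = ∑ j, (a : Matrix (Fin n) (Fin n) C(Ω, ℂ)) i j ω * ξ j := by
  exact congrFun (Matrix.ofLp_toEuclideanCLM (𝕜 := ℂ) (n := Fin n)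
    (Matrix.of fun i j => (a : Matrix (Fin n) (Fin n) C(Ω, ℂ)) i j ω) ξ) i

theorem evRep_star (S : StarSubalgebra ℂ (Matrix (Fin n) (Fin n) C(Ω, ℂ))) (ω : Ω) (a : S)
    (ξ η : EuclideanSpace ℂ (Fin n)) :
    ⟪evRep S ω (star a) ξ, η⟫_ℂ = ⟪ξ, evRep S ω a η⟫_ℂ := by
  have : evRep S ω (star a) = star (evRep S ω a) := by
    exact map_star (Matrix.toEuclideanCLM (𝕜 := ℂ) (n := Fin n))
      (Matrix.of fun i j => (a : Matrix (Fin n) (Fin n) C(Ω, ℂ)) i j ω)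
  rw [this, ContinuousLinearMap.star_eq_adjoint, ContinuousLinearMap.adjoint_inner_left]

theorem entry_le (a : Matrix (Fin n) (Fin n) C(Ω, ℂ)) (i j : Fin n) (ω : Ω) :
    ‖a i j ω‖ ≤ ‖a‖ := by
  refine (ContinuousMap.norm_coe_le_norm (a i j) ω).trans ?_
  rw [Matrix.linfty_opNorm_def, ← coe_nnnorm, NNReal.coe_le_coe]
  refine le_trans ?_ (Finset.le_sup (Finset.mem_univ i))
  exact Finset.single_le_sum (f := fun j => ‖a i j‖₊) (fun _ _ => zero_le) (Finset.mem_univ j)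

theorem norm_le_entry (a : Matrix (Fin n) (Fin n) C(Ω, ℂ)) (M : ℝ) (hM : 0 ≤ M)
    (h : ∀ i j ω, ‖a i j ω‖ ≤ M) : ‖a‖ ≤ n * M := by
  lift M to NNReal using hM
  rw [Matrix.linfty_opNorm_def]
  have : (n : ℝ) * M = ((n * M : NNReal) : ℝ) := by push_cast; rfl
  rw [this, NNReal.coe_le_coe]
  refine Finset.sup_le fun i _ => ?_
  refine (Finset.sum_le_card_nsmul _ _ M fun j _ => ?_).trans (by simp)
  rw [← NNReal.coe_le_coe, coe_nnnorm]
  exact (ContinuousMap.norm_le _ M.2).2 fun ω => h i j ω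

theorem evRep_cont (S : StarSubalgebra ℂ (Matrix (Fin n) (Fin n) C(Ω, ℂ))) :
    Continuous fun p : S × Ω × EuclideanSpace ℂ (Fin n) => evRep S p.2.1 p.1 p.2.2 := by
  have : Continuous fun p : S × Ω × EuclideanSpace ℂ (Fin n) =>
      (evRep S p.2.1 p.1 p.2.2).ofLp := by
    refine continuous_pi fun i => ?_
    simp only [evRep_coord]
    refine continuous_finsetSum _ fun j _ => ?_
    have h1 : Continuous fun a : S => (a : Matrix (Fin n) (Fin n) C(Ω, ℂ)) i j :=
      (continuous_apply_apply i j).comp continuous_subtype_val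
    have h2 : Continuous fun p : S × Ω × EuclideanSpace ℂ (Fin n) =>
      (p.1 : Matrix (Fin n) (Fin n) C(Ω, ℂ)) i j p.2.1 :=
        (h1.comp continuous_fst).eval (by fun_prop)
    exact h2.mul (by fun_prop)
  exact (PiLp.continuous_toLp 2 _).comp this

theorem evRep_poly (S : StarSubalgebra ℂ (Matrix (Fin n) (Fin n) C(Ω, ℂ))) (ω : Ω) (h : S)
    (ξ : EuclideanSpace ℂ (Fin n)) (l : ℂ) (hl : evRep S ω h ξ = l • ξ) (q : Polynomial ℂ) :
    evRep S ω (Polynomial.aeval h q) ξ = q.eval l • ξ := by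
  induction q using Polynomial.induction_on' with
  | add p q hp hq => rw [map_add, map_add, add_apply, hp, hq, Polynomial.eval_add, add_smul]
  | monomial k c =>
    have hk : ∀ k : ℕ, evRep S ω (h ^ k) ξ = l ^ k • ξ := by
      intro k
      induction k with
      | zero => simp
      | succ k ih => rw [pow_succ, map_mul, mul_apply_eq_comp, hl, map_smul, ih, smul_smul, pow_succ,
          mul_comm]
    rw [Polynomial.aeval_monomial, ← Algebra.smul_def, map_smul, smul_apply, hk,
      Polynomial.eval_monomial, smul_smul]

theorem star_poly (S : StarSubalgebra ℂ (Matrix (Fin n) (Fin n) C(Ω, ℂ))) (h : S)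
    (hh : star h = h) (p : Polynomial ℝ) :
    star (Polynomial.aeval h (p.map (algebraMap ℝ ℂ))) =
      Polynomial.aeval h (p.map (algebraMap ℝ ℂ)) := by
  rw [Polynomial.aeval_eq_sum_range, star_sum]
  refine Finset.sum_congr rfl fun i _ => ?_
  rw [star_smul, star_pow, hh]
  simp

theorem diag_bound {E : Type*} [NormedAddCommGroup E] [InnerProductSpace ℂ E] {k : ℕ}
    (b : OrthonormalBasis (Fin k) ℂ E) (T : E →L[ℂ] E) (c : Fin k → ℂ) (M : ℝ)
    (hT : ∀ i, T (b i) = c i • b i) (hc : ∀ i, ‖c i‖ ≤ M) (ξ : E) : ‖T ξ‖ ≤ k * M * ‖ξ‖ := by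
  conv_lhs => rw [← b.sum_repr' ξ]
  rw [map_sum]
  refine (norm_sum_le_of_le (f := fun i => T (⟪b i, ξ⟫_ℂ • b i)) _
    (n := fun _ => M * ‖ξ‖) fun i _ => ?_).trans (by simp [mul_assoc])
  rw [map_smul, hT, norm_smul, norm_smul, b.norm_eq_one, mul_one, mul_comm]
  have h1 : ‖⟪b i, ξ⟫_ℂ‖ ≤ ‖ξ‖ := by
    simpa [b.norm_eq_one] using norm_inner_le_norm (𝕜 := ℂ) (b i) ξ
  exact mul_le_mul (hc i) h1 (norm_nonneg _) ((norm_nonneg _).trans (hc i))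

theorem entry_of_op (S : StarSubalgebra ℂ (Matrix (Fin n) (Fin n) C(Ω, ℂ))) (ω : Ω) (a : S)
    (M : ℝ) (h : ∀ ξ, ‖evRep S ω a ξ‖ ≤ M * ‖ξ‖) (i j : Fin n) :
    ‖(a : Matrix (Fin n) (Fin n) C(Ω, ℂ)) i j ω‖ ≤ M := by
  have h1 := h (EuclideanSpace.single j 1)
  have h2 : evRep S ω a (EuclideanSpace.single j 1) i =
      (a : Matrix (Fin n) (Fin n) C(Ω, ℂ)) i j ω := by
    rw [evRep_coord]
    simp
  rw [← h2]
  refine (PiLp.norm_apply_le _ i).trans ?_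
  simpa using h1

theorem op_bound (S : StarSubalgebra ℂ (Matrix (Fin n) (Fin n) C(Ω, ℂ))) (a : S) :
    ∃ r : ℝ, 0 ≤ r ∧ ∀ ω ξ, ‖evRep S ω a ξ‖ ≤ r * ‖ξ‖ := by
  refine ⟨n * (n * ‖(a : Matrix (Fin n) (Fin n) C(Ω, ℂ))‖), by positivity, fun ω ξ => ?_⟩
  have h1 : ‖evRep S ω a ξ‖ ≤ ∑ i, ‖evRep S ω a ξ i‖ := by
    conv_lhs => rw [← (EuclideanSpace.basisFun (Fin n) ℂ).sum_repr (evRep S ω a ξ)]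
    refine (norm_sum_le _ _).trans ?_
    simp [norm_smul]
  refine h1.trans ((Finset.sum_le_card_nsmul _ _
    (n * ‖(a : Matrix (Fin n) (Fin n) C(Ω, ℂ))‖ * ‖ξ‖) fun i _ => ?_).trans (by simp [mul_assoc]))
  rw [evRep_coord]
  refine (norm_sum_le _ _).trans ((Finset.sum_le_card_nsmul _ _
    (‖(a : Matrix (Fin n) (Fin n) C(Ω, ℂ))‖ * ‖ξ‖) fun j _ => ?_).trans (by simp [mul_assoc]))
  rw [norm_mul]
  exact mul_le_mul (entry_le _ _ _ _) (PiLp.norm_apply_le _ _) (norm_nonneg _) (norm_nonneg _)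

theorem evRep_cfc (S : StarSubalgebra ℂ (Matrix (Fin n) (Fin n) C(Ω, ℂ)))
    (hS : IsClosed (S : Set (Matrix (Fin n) (Fin n) C(Ω, ℂ)))) (h : S) (hh : star h = h)
    (f : ℝ → ℝ) (hf : Continuous f) : ∃ s : S, star s = s ∧
      ∀ ω ξ (l : ℝ), evRep S ω h ξ = (l : ℂ) • ξ → evRep S ω s ξ = (f l : ℂ) • ξ := by
  obtain ⟨r, hr0, hr⟩ := op_bound S h
  choose p hp using fun k : ℕ => exists_polynomial_near_of_continuousOn (-r) r f hf.continuousOn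
    (1 / ((k : ℝ) + 1)) Nat.one_div_pos_of_nat
  have hlr : ∀ ω ξ (l : ℝ), ξ ≠ 0 → evRep S ω h ξ = (l : ℂ) • ξ → l ∈ Set.Icc (-r) r := by
    intro ω ξ l hξ hl
    have h1 := hr ω ξ
    rw [hl, norm_smul, Complex.norm_real] at h1
    exact abs_le.1 (le_of_mul_le_mul_right h1 (norm_pos_iff.2 hξ))
  let t : ℕ → S := fun k => Polynomial.aeval h ((p k).map (algebraMap ℝ ℂ))
  have hts : ∀ k, star (t k) = t k := fun k => star_poly S h hh (p k)
  have htl : ∀ k ω ξ (l : ℝ), evRep S ω h ξ = (l : ℂ) • ξ →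
      evRep S ω (t k) ξ = (((p k).eval l : ℝ) : ℂ) • ξ := by
    intro k ω ξ l hl
    rw [evRep_poly S ω h ξ l hl]
    congr 1
    rw [Polynomial.eval_map]
    exact (Polynomial.eval₂_at_apply (algebraMap ℝ ℂ) l)
  have hdiff : ∀ k m N : ℕ, N ≤ k → N ≤ m → ‖(t k : Matrix (Fin n) (Fin n) C(Ω, ℂ)) - t m‖ ≤
      n * (n * (2 * (1 / ((N : ℝ) + 1)))) := by
    intro k m N hk hm
    refine norm_le_entry _ _ (by positivity) fun i j ω => ?_
    refine entry_of_op S ω (t k - t m) _ (fun ξ => ?_) i j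
    have hT : (evRep S ω h).toLinearMap.IsSymmetric := by
      intro x y
      have := evRep_star S ω h x y
      rw [hh] at this
      exact this
    let b := hT.eigenvectorBasis (n := n) (by simp)
    have hb : ∀ i, evRep S ω h (b i) = ((hT.eigenvalues (n := n) (by simp) i : ℝ) : ℂ) • b i :=
      fun i => hT.apply_eigenvectorBasis (by simp) i
    refine diag_bound b (evRep S ω (t k - t m)) (fun i =>
      (((p k).eval (hT.eigenvalues (n := n) (by simp) i)
        - (p m).eval (hT.eigenvalues (n := n) (by simp) i) : ℝ) : ℂ)) _ (fun i => ?_)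
        (fun i => ?_) ξ
    · rw [map_sub, sub_apply, htl k ω _ _ (hb i), htl m ω _ _ (hb i), ← sub_smul]
      push_cast
      rfl
    · rw [Complex.norm_real, Real.norm_eq_abs]
      have hmem := hlr ω (b i) _ (b.orthonormal.ne_zero i) (hb i)
      have h1 := hp k _ hmem
      have h2 := hp m _ hmem
      have h3 : 1 / ((k : ℝ) + 1) ≤ 1 / ((N : ℝ) + 1) := Nat.one_div_le_one_div hk
      have h4 : 1 / ((m : ℝ) + 1) ≤ 1 / ((N : ℝ) + 1) := Nat.one_div_le_one_div hm
      rw [abs_lt] at h1 h2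
      rw [abs_le]
      constructor <;> linarith [h1.1, h1.2, h2.1, h2.2]
  have hcau : CauchySeq fun k => (t k : Matrix (Fin n) (Fin n) C(Ω, ℂ)) := by
    refine cauchySeq_of_le_tendsto_0 (fun N : ℕ => (n : ℝ) * (n * (2 * (1 / ((N : ℝ) + 1))))) ?_ ?_
    · intro k m N hk hm
      rw [dist_eq_norm]
      exact hdiff k m N hk hm
    · have := (((tendsto_one_div_add_atTop_nhds_zero_nat (𝕜 := ℝ)).const_mul 2).const_mul
        (n : ℝ)).const_mul (n : ℝ)
      simpa using this
  haveI : CompleteSpace (Matrix (Fin n) (Fin n) C(Ω, ℂ)) :=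
    inferInstanceAs (CompleteSpace (Fin n → Fin n → C(Ω, ℂ)))
  obtain ⟨s, hs⟩ := cauchySeq_tendsto_of_complete hcau
  have hsS : s ∈ S := hS.mem_of_tendsto hs (Filter.Eventually.of_forall fun k => (t k).2)
  have hs' : Filter.Tendsto t Filter.atTop (nhds (⟨s, hsS⟩ : S)) := tendsto_subtype_rng.2 hs
  refine ⟨⟨s, hsS⟩, ?_, ?_⟩
  · apply Subtype.ext
    have h1 : Filter.Tendsto (fun k => star (t k : Matrix (Fin n) (Fin n) C(Ω, ℂ))) Filter.atTop
      (nhds (star s)) := (continuous_star.tendsto s).comp hs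
    have h2 : (fun k => star (t k : Matrix (Fin n) (Fin n) C(Ω, ℂ))) = fun k =>
      (t k : Matrix (Fin n) (Fin n) C(Ω, ℂ)) :=
      funext fun k => congrArg Subtype.val (hts k)
    rw [h2] at h1
    exact tendsto_nhds_unique h1 hs
  · intro ω ξ l hl
    by_cases hξ : ξ = 0
    · subst hξ
      simp
    have hmem := hlr ω ξ l hξ hl
    have h1 : Filter.Tendsto (fun k => evRep S ω (t k) ξ) Filter.atTop
        (nhds (evRep S ω ⟨s, hsS⟩ ξ)) :=
      (((evRep_cont S).comp (by fun_prop : Continuous fun a : S => (a, ω, ξ))).tendsto _).comp hs'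
    have h2 : Filter.Tendsto (fun k => (p k).eval l) Filter.atTop (nhds (f l)) := by
      rw [tendsto_iff_dist_tendsto_zero]
      refine squeeze_zero (fun _ => dist_nonneg) (fun k => ?_)
        (tendsto_one_div_add_atTop_nhds_zero_nat (𝕜 := ℝ))
      exact (hp k l hmem).le
    have h3 : Filter.Tendsto (fun k => (((p k).eval l : ℝ) : ℂ) • ξ) Filter.atTop
        (nhds ((f l : ℂ) • ξ)) :=
      ((Complex.continuous_ofReal.tendsto _).comp h2).smul_const ξ
    have h4 : (fun k => evRep S ω (t k) ξ) = fun k => (((p k).eval l : ℝ) : ℂ) • ξ :=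
      funext fun k => htl k ω ξ l hl
    rw [h4] at h1
    exact tendsto_nhds_unique h1 h3

/-- The concrete field. -/
def evFld (S : StarSubalgebra ℂ (Matrix (Fin n) (Fin n) C(Ω, ℂ)))
    (hS : IsClosed (S : Set (Matrix (Fin n) (Fin n) C(Ω, ℂ)))) :
    Fld S Ω (EuclideanSpace ℂ (Fin n)) where
  rep := evRep S
  hstar := evRep_star S
  hcont := evRep_cont S
  hcfc := evRep_cfc S hS

end Concrete

section Final

theorem form_le {ι : Type*} [Fintype ι] [DecidableEq ι] (B : Matrix ι ι ℂ)
    (u v : EuclideanSpace ℂ ι) :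
    ‖∑ p, ∑ q, (starRingEnd ℂ) (u p) * B p q * v q‖ ≤
      ‖Matrix.toEuclideanCLM (𝕜 := ℂ) (n := ι) B‖ * (‖u‖ * ‖v‖) := by
  have h : ∑ p, ∑ q, (starRingEnd ℂ) (u p) * B p q * v q
      = ⟪u, Matrix.toEuclideanCLM (𝕜 := ℂ) (n := ι) B v⟫_ℂ := by
    rw [PiLp.inner_apply]
    refine Finset.sum_congr rfl fun p _ => ?_
    rw [Matrix.ofLp_toEuclideanCLM, Matrix.mulVec, dotProduct, RCLike.inner_apply,
      Finset.sum_mul]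
    refine Finset.sum_congr rfl fun q _ => ?_
    ring
  rw [h]
  refine (norm_inner_le_norm _ _).trans ?_
  have := (Matrix.toEuclideanCLM (𝕜 := ℂ) (n := ι) B).le_opNorm v
  nlinarith [norm_nonneg u]

theorem op_le {ι : Type*} [Fintype ι] [DecidableEq ι] (B : Matrix ι ι ℂ) (C : ℝ) (hC : 0 ≤ C)
    (h : ∀ u v : EuclideanSpace ℂ ι,
      ‖∑ p, ∑ q, (starRingEnd ℂ) (u p) * B p q * v q‖ ≤ C * (‖u‖ * ‖v‖)) :
    ‖Matrix.toEuclideanCLM (𝕜 := ℂ) (n := ι) B‖ ≤ C := by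
  refine ContinuousLinearMap.opNorm_le_bound _ hC fun v => ?_
  set w := Matrix.toEuclideanCLM (𝕜 := ℂ) (n := ι) B v with hw
  have h1 := h w v
  have h2 : ∑ p, ∑ q, (starRingEnd ℂ) (w p) * B p q * v q = ⟪w, w⟫_ℂ := by
    conv_rhs => rw [hw]
    rw [← hw, PiLp.inner_apply]
    refine Finset.sum_congr rfl fun p _ => ?_
    rw [RCLike.inner_apply]
    have : w p = ∑ q, B p q * v q := rfl
    conv_rhs => rw [this, Finset.sum_mul]
    refine Finset.sum_congr rfl fun q _ => ?_
    rw [this]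
    ring
  rw [h2, inner_self_eq_norm_sq_to_K] at h1
  have h3 : ‖w‖ * ‖w‖ ≤ ‖w‖ * (C * ‖v‖) := by
    simp at h1
    nlinarith
  rcases (norm_nonneg w).eq_or_lt with h0 | h0
  · rw [← h0]
    positivity
  · exact le_of_mul_le_mul_left h3 h0

theorem crude_le {ι : Type*} [Fintype ι] [DecidableEq ι] (B : Matrix ι ι ℂ) (M : ℝ) (hM : 0 ≤ M)
    (h : ∀ p q, ‖B p q‖ ≤ M) :
    ‖Matrix.toEuclideanCLM (𝕜 := ℂ) (n := ι) B‖ ≤ Fintype.card ι * (Fintype.card ι * M) := by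
  refine op_le B _ (by positivity) fun u v => ?_
  refine (norm_sum_le _ _).trans ((Finset.sum_le_card_nsmul _ _
    (Fintype.card ι * M * (‖u‖ * ‖v‖)) fun p _ => ?_).trans (by simp [mul_assoc]))
  refine (norm_sum_le _ _).trans ((Finset.sum_le_card_nsmul _ _
    (M * (‖u‖ * ‖v‖)) fun q _ => ?_).trans (by simp [mul_assoc]))
  rw [norm_mul, norm_mul, RCLike.norm_conj]
  have h1 := PiLp.norm_apply_le u p
  have h2 := PiLp.norm_apply_le v q
  calc ‖u p‖ * ‖B p q‖ * ‖v q‖ ≤ ‖u‖ * M * ‖v‖ := by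
        gcongr
        exact h p q
    _ = M * (‖u‖ * ‖v‖) := by ring

theorem pt_le (S : StarSubalgebra ℂ (Matrix (Fin n) (Fin n) C(Ω, ℂ))) (m : ℕ)
    (x : Matrix (Fin m) (Fin m) S) (hx : matNorm S m x ≤ 1) (ω : Ω) :
    ‖Matrix.toEuclideanCLM (𝕜 := ℂ) (n := Fin m × Fin n)
      (Matrix.of fun p q => ((x p.1 q.1 : Matrix (Fin n) (Fin n) C(Ω, ℂ)) p.2 q.2) ω)‖ ≤ 1 := by
  refine le_trans ?_ hx
  refine le_ciSup (f := fun ω => ‖Matrix.toEuclideanCLM (𝕜 := ℂ) (n := Fin m × Fin n)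
      (Matrix.of fun p q => ((x p.1 q.1 : Matrix (Fin n) (Fin n) C(Ω, ℂ)) p.2 q.2) ω)‖) ?_ ω
  refine ⟨Fintype.card (Fin m × Fin n) * (Fintype.card (Fin m × Fin n) *
    ∑ i, ∑ j, ‖(x i j : Matrix (Fin n) (Fin n) C(Ω, ℂ))‖), ?_⟩
  · rintro _ ⟨ω, rfl⟩
    refine crude_le _ (∑ i, ∑ j, ‖(x i j : Matrix (Fin n) (Fin n) C(Ω, ℂ))‖) (by positivity) ?_
    intro p q
    refine (entry_le (x p.1 q.1 : Matrix (Fin n) (Fin n) C(Ω, ℂ)) p.2 q.2 ω).trans ?_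
    refine (Finset.single_le_sum (f := fun j => ‖(x p.1 j : Matrix (Fin n) (Fin n) C(Ω, ℂ))‖)
      (fun _ _ => norm_nonneg _) (Finset.mem_univ q.1)).trans ?_
    exact Finset.single_le_sum
      (f := fun i => ∑ j, ‖(x i j : Matrix (Fin n) (Fin n) C(Ω, ℂ))‖)
      (fun _ _ => Finset.sum_nonneg fun _ _ => norm_nonneg _) (Finset.mem_univ p.1)

/-- slice -/
def sl {m : ℕ} (u : EuclideanSpace ℂ (Fin m × Fin n)) (k : Fin n) : EuclideanSpace ℂ (Fin m) :=
  WithLp.toLp 2 fun i => u (i, k)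

theorem sl_norm {m : ℕ} (u : EuclideanSpace ℂ (Fin m × Fin n)) (k : Fin n) : ‖sl u k‖ ≤ ‖u‖ := by
  rw [EuclideanSpace.norm_eq, EuclideanSpace.norm_eq]
  apply Real.sqrt_le_sqrt
  rw [Fintype.sum_prod_type]
  refine Finset.sum_le_sum fun i _ => ?_
  exact Finset.single_le_sum (f := fun k => ‖u (i, k)‖ ^ 2) (fun _ _ => by positivity)
    (Finset.mem_univ k)

/-- tensor with a basis vector -/
def tn {m : ℕ} (α : EuclideanSpace ℂ (Fin m)) (k : Fin n) : EuclideanSpace ℂ (Fin m × Fin n) :=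
  WithLp.toLp 2 fun p => if p.2 = k then α p.1 else 0

theorem tn_norm {m : ℕ} (α : EuclideanSpace ℂ (Fin m)) (k : Fin n) : ‖tn α k‖ = ‖α‖ := by
  rw [EuclideanSpace.norm_eq, EuclideanSpace.norm_eq]
  congr 1
  rw [Fintype.sum_prod_type]
  refine Finset.sum_congr rfl fun i _ => ?_
  rw [Finset.sum_eq_single k]
  · simp [tn]
  · intro j _ hj
    simp [tn, hj]
  · simp

/-- compression -/
def cpr {S : StarSubalgebra ℂ (Matrix (Fin n) (Fin n) C(Ω, ℂ))} {m : ℕ}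
    (x : Matrix (Fin m) (Fin m) S) (α β : EuclideanSpace ℂ (Fin m)) : S :=
  ∑ i, ∑ j, ((starRingEnd ℂ) (α i) * β j) • x i j

theorem entry_sum (S : StarSubalgebra ℂ (Matrix (Fin n) (Fin n) C(Ω, ℂ))) {m : ℕ}
    (c : Fin m → Fin m → ℂ) (x : Fin m → Fin m → S) (k l : Fin n) (ω : Ω) :
    ((∑ i, ∑ j, c i j • x i j : S) : Matrix (Fin n) (Fin n) C(Ω, ℂ)) k l ω
      = ∑ i, ∑ j, c i j * (x i j : Matrix (Fin n) (Fin n) C(Ω, ℂ)) k l ω := by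
  let g : S →ₗ[ℂ] ℂ :=
    { toFun := fun a => (a : Matrix (Fin n) (Fin n) C(Ω, ℂ)) k l ω
      map_add' := fun a b => rfl
      map_smul' := fun a b => rfl }
  change g _ = _
  rw [map_sum]
  refine Finset.sum_congr rfl fun i _ => ?_
  rw [map_sum]
  refine Finset.sum_congr rfl fun j _ => ?_
  rw [map_smul]
  rfl

theorem cpr_norm (S : StarSubalgebra ℂ (Matrix (Fin n) (Fin n) C(Ω, ℂ))) {m : ℕ}
    (x : Matrix (Fin m) (Fin m) S) (hx : matNorm S m x ≤ 1) (α β : EuclideanSpace ℂ (Fin m)) :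
    ‖cpr x α β‖ ≤ n * (‖α‖ * ‖β‖) := by
  refine norm_le_entry _ _ (by positivity) fun k l ω => ?_
  have h0 : (cpr x α β : Matrix (Fin n) (Fin n) C(Ω, ℂ)) k l ω = ∑ i, ∑ j,
      ((starRingEnd ℂ) (α i) * β j) * (x i j : Matrix (Fin n) (Fin n) C(Ω, ℂ)) k l ω :=
    entry_sum S (fun i j => (starRingEnd ℂ) (α i) * β j) x k l ω
  refine le_trans (le_of_eq (congrArg norm h0)) ?_
  have h1 := form_le (Matrix.of fun p q =>
    ((x p.1 q.1 : Matrix (Fin n) (Fin n) C(Ω, ℂ)) p.2 q.2) ω) (tn α k) (tn β l)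
  rw [tn_norm, tn_norm] at h1
  refine le_trans (le_of_eq ?_) (h1.trans
    (mul_le_of_le_one_left (by positivity) (pt_le S m x hx ω)))
  congr 1
  rw [Fintype.sum_prod_type]
  refine Finset.sum_congr rfl fun i _ => ?_
  rw [Finset.sum_eq_single k]
  · rw [Fintype.sum_prod_type]
    refine Finset.sum_congr rfl fun j _ => ?_
    rw [Finset.sum_eq_single l]
    · simp [tn]
      ring
    · intro l' _ hl
      simp [tn, hl]
    · simp
  · intro k' _ hk
    simp [tn, hk]
  · simp

theorem cb_bound (S : StarSubalgebra ℂ (Matrix (Fin n) (Fin n) C(Ω, ℂ))) (ψ : S →ₗ[ℂ] S) (δ : ℝ)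
    (hδ : 0 ≤ δ) (hψ : ∀ x, ‖x‖ ≤ 1 → ∀ ω ξ, ‖evRep S ω (ψ x) ξ‖ ≤ δ * ‖ξ‖) (m : ℕ)
    (x : Matrix (Fin m) (Fin m) S) (hx : matNorm S m x ≤ 1) (ω : Ω) :
    ‖Matrix.toEuclideanCLM (𝕜 := ℂ) (n := Fin m × Fin n)
      (Matrix.of fun p q => ((ψ (x p.1 q.1) : Matrix (Fin n) (Fin n) C(Ω, ℂ)) p.2 q.2) ω)‖
      ≤ n * (n * (δ * n)) := by
  have hent : ∀ (a : S) k l, ‖(ψ a : Matrix (Fin n) (Fin n) C(Ω, ℂ)) k l ω‖ ≤ δ * ‖a‖ := by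
    intro a k l
    rcases (norm_nonneg a).eq_or_lt with h0 | h0
    · have : a = 0 := norm_eq_zero.1 h0.symm
      subst this
      rw [map_zero]
      simp
    · have h1 := entry_of_op S ω (ψ (((‖a‖⁻¹ : ℝ) : ℂ) • a)) δ (hψ _ (by
        rw [norm_smul, Complex.norm_real, norm_inv, norm_norm]
        exact (inv_mul_cancel₀ h0.ne').le) ω) k l
      rw [map_smul] at h1
      have h2 : ((((‖a‖⁻¹ : ℝ) : ℂ) • ψ a : S) : Matrix (Fin n) (Fin n) C(Ω, ℂ)) k l ω =
        ((‖a‖⁻¹ : ℝ) : ℂ) * (ψ a : Matrix (Fin n) (Fin n) C(Ω, ℂ)) k l ω := rfl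
      rw [h2, norm_mul, Complex.norm_real, norm_inv, norm_norm, inv_mul_le_iff₀ h0] at h1
      linarith
  refine op_le _ _ (by positivity) fun u v => ?_
  have hsum : ∑ p, ∑ q, (starRingEnd ℂ) (u p) *
      (Matrix.of fun p q : Fin m × Fin n =>
        ((ψ (x p.1 q.1) : Matrix (Fin n) (Fin n) C(Ω, ℂ)) p.2 q.2) ω) p q * v q
      = ∑ k, ∑ l, (ψ (cpr x (sl u k) (sl v l)) : Matrix (Fin n) (Fin n) C(Ω, ℂ)) k l ω := by
    rw [Fintype.sum_prod_type, Finset.sum_comm]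
    refine Finset.sum_congr rfl fun k _ => ?_
    have h1 : ∀ l, (ψ (cpr x (sl u k) (sl v l)) : Matrix (Fin n) (Fin n) C(Ω, ℂ)) k l ω
        = ∑ i, ∑ j, ((starRingEnd ℂ) (u (i, k)) * v (j, l)) *
          (ψ (x i j) : Matrix (Fin n) (Fin n) C(Ω, ℂ)) k l ω := by
      intro l
      have h2 : ψ (cpr x (sl u k) (sl v l)) =
          ∑ i, ∑ j, ((starRingEnd ℂ) (u (i, k)) * v (j, l)) • ψ (x i j) := by
        simp only [cpr, map_sum, map_smul]
        rfl
      rw [h2, entry_sum]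
    refine Eq.trans ?_ (Finset.sum_congr rfl fun l _ => h1 l).symm
    rw [Finset.sum_comm (s := (Finset.univ : Finset (Fin n)))]
    refine Finset.sum_congr rfl fun i _ => ?_
    rw [Fintype.sum_prod_type, Finset.sum_comm]
    refine Finset.sum_congr rfl fun l _ => ?_
    refine Finset.sum_congr rfl fun j _ => ?_
    rw [Matrix.of_apply]
    ring
  rw [hsum]
  refine (norm_sum_le_of_le _ (n := fun _ => n * (δ * n) * (‖u‖ * ‖v‖))
    fun k _ => ?_).trans (by simp [mul_assoc])
  refine (norm_sum_le_of_le _ (n := fun _ => (δ * n) * (‖u‖ * ‖v‖))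
    fun l _ => ?_).trans (by simp [mul_assoc])
  refine (hent _ _ _).trans ?_
  rw [mul_assoc]
  refine mul_le_mul_of_nonneg_left ((cpr_norm S x hx _ _).trans ?_) hδ
  have := sl_norm u k
  have := sl_norm v l
  gcongr

end Final

end CCSub

/-- Every compact linear map on a C*-algebra that is (realized as) a C*-subalgebra of
`M_n ⊗ C(Ω)` is completely compact. -/
theorem completelyCompact_of_compact_subhomogeneous
    (S : StarSubalgebra ℂ (Matrix (Fin n) (Fin n) C(Ω, ℂ))) (hS : IsClosed (S : Set (Matrix (Fin n) (Fin n) C(Ω, ℂ))))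
    (φ : S → S) (hlin : IsLinearMap ℂ φ) (hcompact : IsCompactOperator φ) :
    CompletelyCompactWrt (matNorm S) (matNorm S) φ := by
  intro ε hε
  let φ' : S →ₗ[ℂ] S := hlin.mk' φ
  have hN : (0 : ℝ) < 2 * ((n : ℝ) * (n * n) + 1) := by positivity
  set δ : ℝ := ε / (2 * ((n : ℝ) * (n * n) + 1)) with hδdef
  have hδ : 0 < δ := div_pos hε hN
  obtain ⟨R, -, ⟨F, hF, hRF⟩, δ', hδ', hR⟩ := (CCSub.evFld S hS).main φ' hcompact hδ
  refine ⟨F, hF, fun m x hx => ⟨x.map R, fun i j => hRF _, ?_⟩⟩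
  have hb : ∀ ω, ‖Matrix.toEuclideanCLM (𝕜 := ℂ) (n := Fin m × Fin n)
      (Matrix.of fun p q => (((φ' - R) (x p.1 q.1) : S) : Matrix (Fin n) (Fin n) C(Ω, ℂ))
        p.2 q.2 ω)‖ ≤ n * (n * (δ * n)) :=
    CCSub.cb_bound S (φ' - R) δ hδ.le (fun a ha ω ξ => (hR a ha ω ξ trivial).trans
      (mul_le_mul_of_nonneg_right hδ'.le (norm_nonneg _))) m x hx
  have h1 : matNorm S m (x.map φ - x.map R) ≤ n * (n * (δ * n)) :=
    Real.iSup_le hb (by positivity)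
  refine h1.trans_lt ?_
  have h2 : (n : ℝ) * (n * (δ * n)) = δ * (n * (n * n)) := by ring
  have h3 : δ * (2 * ((n : ℝ) * (n * n) + 1)) = ε := div_mul_cancel₀ _ hN.ne'
  rw [h2]
  have h4 : 0 ≤ δ * ((n : ℝ) * (n * n)) := by positivity
  nlinarith

end
end
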